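/- arXiv:1811.06718 — 3 statements merged into one kernel-verified Lean document; each statement's English description precedes it below -/
import Mathlib

section
/- Every ABC-tile T tiles ℝ³ by the lattice ℤ³: the union ⋃_{α ∈ ℤ³} (T + α) equals ℝ³, and for any two distinct α₁, α₂ ∈ ℤ³ the intersection (T + α₁) ∩ (T + α₂) has Lebesgue measure zero. -/
open MeasureTheory

noncomputable def Mmat (A B C : ℤ) : Matrix (Fin 3) (Fin 3) ℝ :=
  !![0, 0, -(C : ℝ); 1, 0, -(B : ℝ); 0, 1, -(A : ℝ)]

def Ddig (C : ℤ) : Set (Fin 3 → ℝ) :=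
  {d | ∃ i : ℤ, 0 ≤ i ∧ i < C ∧ d = ![(i : ℝ), 0, 0]}

def toR (α : Fin 3 → ℤ) : Fin 3 → ℝ := fun i => (α i : ℝ)

def tileTranslate (v : Fin 3 → ℝ) (T : Set (Fin 3 → ℝ)) : Set (Fin 3 → ℝ) :=
  (fun x => x + v) '' T

def IsABCTile (A B C : ℤ) (T : Set (Fin 3 → ℝ)) : Prop :=
  1 ≤ A ∧ A ≤ B ∧ B < C ∧
  T.Nonempty ∧ IsCompact T ∧ 0 < volume T ∧
  (Mmat A B C).mulVec '' T = ⋃ d ∈ Ddig C, tileTranslate d T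

def Neighbors (T : Set (Fin 3 → ℝ)) : Set (Fin 3 → ℤ) :=
  {α | α ≠ 0 ∧ (T ∩ tileTranslate (toR α) T).Nonempty}

/-- One-sided contraction step for the linear recurrence. -/
lemma abc_upper (A B C : ℝ) (hA : 1 ≤ A) (hAB : A ≤ B) (hBC : B + 1 ≤ C) (s : ℕ → ℝ)
    (hs : ∀ n, C * s (n+3) + B * s (n+2) + A * s (n+1) + s n = 0) (K : ℝ)
    (n : ℕ) (hn : ∀ m, n ≤ m → |s m| ≤ K) (m : ℕ) (hm : n + 7 ≤ m) :
    s m ≤ K * (1 - (1/C)^4) := by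
  have hC : 0 < C := by linarith
  have hK : 0 ≤ K := le_trans (abs_nonneg _) (hn n le_rfl)
  have h4 : ∀ l, C * s (l+4) = s l + (A-1) * s (l+1) + (B-A) * s (l+2) + (C-B) * s (l+3) := by
    intro l
    have h1 := hs l
    have h2 := hs (l+1)
    have e1 : l + 1 + 3 = l + 4 := rfl
    have e2 : l + 1 + 2 = l + 3 := rfl
    have e3 : l + 1 + 1 = l + 2 := rfl
    rw [e1, e2, e3] at h2
    linarith
  have hub : ∀ l, n ≤ l → 0 ≤ K - s l := fun l hl => by
    have := (abs_le.mp (hn l hl)).2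
    linarith
  have h1 : ∀ l, n ≤ l → (1/C) * (K - s l) ≤ K - s (l+4) := by
    intro l hl
    have e := h4 l
    have p1 := mul_nonneg (sub_nonneg.2 hA) (hub (l+1) (by omega))
    have p2 := mul_nonneg (sub_nonneg.2 hAB) (hub (l+2) (by omega))
    have p3 := mul_nonneg (by linarith : 0 ≤ C - B) (hub (l+3) (by omega))
    rw [one_div, inv_mul_le_iff₀ hC]
    nlinarith
  have h2 : ∀ l, n + 3 ≤ l → (1/C) * (K - s l) ≤ K - s (l+1) := by
    intro l hl
    obtain ⟨k, rfl⟩ : ∃ k, l = k + 3 := ⟨l - 3, by omega⟩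
    have e := h4 k
    have p0 := hub k (by omega)
    have p1 := mul_nonneg (sub_nonneg.2 hA) (hub (k+1) (by omega))
    have p2 := mul_nonneg (sub_nonneg.2 hAB) (hub (k+2) (by omega))
    have p3 := mul_nonneg (by linarith : 0 ≤ C - B - 1) (hub (k+3) (by omega))
    rw [one_div, inv_mul_le_iff₀ hC]
    have e1 : k + 3 + 1 = k + 4 := rfl
    rw [e1]
    nlinarith
  set δ := 1 / C with hδ
  have hδ0 : 0 ≤ δ := by positivity
  have hδ1 : δ ≤ 1 := by rw [hδ, div_le_one hC]; linarith
  obtain ⟨p, rfl⟩ : ∃ p, m = p + 7 := ⟨m - 7, by omega⟩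
  have hp : n ≤ p := by omega
  obtain ⟨j, hj, hsj⟩ : ∃ j, j ≤ 3 ∧ s (p + j) ≤ 0 := by
    by_contra hcon
    push Not at hcon
    have q0 := hcon 0 (by norm_num)
    have q1 := hcon 1 (by norm_num)
    have q2 := hcon 2 (by norm_num)
    have q3 := hcon 3 (by norm_num)
    have := hs p
    have a1 : 0 < C * s (p+3) := by positivity
    have a2 : 0 < B * s (p+2) := mul_pos (by linarith) q2
    have a3 : 0 < A * s (p+1) := mul_pos (by linarith) q1
    simp only [add_zero] at q0
    linarith
  have key : ∀ k, δ ^ (k+1) * K ≤ K - s (p + j + 4 + k) := by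
    intro k
    induction k with
    | zero =>
      have := h1 (p+j) (by omega)
      have h3 : δ * K ≤ δ * (K - s (p+j)) := mul_le_mul_of_nonneg_left (by linarith) hδ0
      simpa using h3.trans this
    | succ k ih =>
      have := h2 (p+j+4+k) (by omega)
      have h3 := mul_le_mul_of_nonneg_left ih hδ0
      calc δ ^ (k+1+1) * K = δ * (δ ^ (k+1) * K) := by ring
        _ ≤ _ := h3
        _ ≤ _ := this
  have h := key (3 - j)
  have e : p + j + 4 + (3 - j) = p + 7 := by omega
  rw [e] at h
  have : δ ^ 4 ≤ δ ^ (3 - j + 1) := pow_le_pow_of_le_one hδ0 hδ1 (by omega)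
  nlinarith

lemma abc_decay (A B C : ℝ) (hA : 1 ≤ A) (hAB : A ≤ B) (hBC : B + 1 ≤ C) (s : ℕ → ℝ)
    (hs : ∀ n, C * s (n+3) + B * s (n+2) + A * s (n+1) + s n = 0) :
    Filter.Tendsto s Filter.atTop (nhds 0) := by
  have hC : 0 < C := by linarith
  set K := |s 0| + |s 1| + |s 2| + |s 3| with hKdef
  have hK : ∀ m, |s m| ≤ K := by
    intro m
    induction m using Nat.strong_induction_on with
    | _ m ih =>
      have b0 := abs_nonneg (s 0)
      have b1 := abs_nonneg (s 1)
      have b2 := abs_nonneg (s 2)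
      have b3 := abs_nonneg (s 3)
      match m with
      | 0 => linarith
      | 1 => linarith
      | 2 => linarith
      | 3 => linarith
      | l + 4 =>
        have g1 := hs l
        have g2 := hs (l+1)
        have e1 : l + 1 + 3 = l + 4 := rfl
        have e2 : l + 1 + 2 = l + 3 := rfl
        have e3 : l + 1 + 1 = l + 2 := rfl
        rw [e1, e2, e3] at g2
        have c0 := abs_le.mp (ih l (by omega))
        have c1 := abs_le.mp (ih (l+1) (by omega))
        have c2 := abs_le.mp (ih (l+2) (by omega))
        have c3 := abs_le.mp (ih (l+3) (by omega))
        have hA' : 0 ≤ A - 1 := by linarith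
        have hB' : 0 ≤ B - A := by linarith
        have hC' : 0 ≤ C - B := by linarith
        rw [abs_le]
        constructor
        · have d1 := mul_le_mul_of_nonneg_left c1.1 hA'
          have d2 := mul_le_mul_of_nonneg_left c2.1 hB'
          have d3 := mul_le_mul_of_nonneg_left c3.1 hC'
          refine le_of_mul_le_mul_left ?_ hC
          nlinarith [c0.1]
        · have d1 := mul_le_mul_of_nonneg_left c1.2 hA'
          have d2 := mul_le_mul_of_nonneg_left c2.2 hB'
          have d3 := mul_le_mul_of_nonneg_left c3.2 hC'
          refine le_of_mul_le_mul_left ?_ hC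
          nlinarith [c0.2]
  set q := 1 - (1/C)^4 with hq
  have hCi : 0 < 1 / C := by positivity
  have hCi1 : 1 / C ≤ 1 := by rw [div_le_one hC]; linarith
  have hq0 : 0 ≤ q := by
    have := pow_le_one₀ hCi.le hCi1 (n := 4)
    linarith
  have hq1 : q < 1 := by
    have := pow_pos hCi 4
    linarith
  have main : ∀ k m, 7 * k ≤ m → |s m| ≤ K * q ^ k := by
    intro k
    induction k with
    | zero => intro m _; simpa using hK m
    | succ k ih =>
      intro m hm
      have u1 := abc_upper A B C hA hAB hBC s hs (K * q^k) (7*k) ih m (by omega)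
      have u2 := abc_upper A B C hA hAB hBC (fun n => - s n)
        (fun n => by have := hs n; linarith) (K * q^k) (7*k)
        (fun m hm => by rw [abs_neg]; exact ih m hm) m (by omega)
      rw [abs_le, pow_succ, ← mul_assoc]
      constructor
      · linarith
      · exact u1
  rw [Metric.tendsto_atTop]
  intro ε hε
  have ht : Filter.Tendsto (fun k => K * q ^ k) Filter.atTop (nhds 0) := by
    simpa using (tendsto_pow_atTop_nhds_zero_of_lt_one hq0 hq1).const_mul K
  obtain ⟨k, hk⟩ := (ht.eventually (gt_mem_nhds hε)).exists
  refine ⟨7 * k, fun m hm => ?_⟩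
  rw [Real.dist_eq, sub_zero]
  exact (main k m hm).trans_lt hk

/-- The inverse of `Mmat`. -/
noncomputable def Nmat (A B C : ℤ) : Matrix (Fin 3) (Fin 3) ℝ :=
  !![-(B : ℝ)/C, 1, 0; -(A : ℝ)/C, 0, 1; -1/(C:ℝ), 0, 0]

lemma Nmat_mul_Mmat (A B C : ℤ) (hC : (C : ℝ) ≠ 0) : Nmat A B C * Mmat A B C = 1 := by
  ext i j
  fin_cases i <;> fin_cases j <;>
    simp [Nmat, Mmat, Matrix.mul_apply, Fin.sum_univ_three] <;> field_simp <;> ring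

lemma Mmat_mul_Nmat (A B C : ℤ) (hC : (C : ℝ) ≠ 0) : Mmat A B C * Nmat A B C = 1 :=
  mul_eq_one_comm.mp (Nmat_mul_Mmat A B C hC)

lemma Nmat_cubic (A B C : ℤ) (hC : (C : ℝ) ≠ 0) :
    (C : ℝ) • (Nmat A B C)^3 + (B : ℝ) • (Nmat A B C)^2 + (A : ℝ) • (Nmat A B C) + 1 = 0 := by
  ext i j
  fin_cases i <;> fin_cases j <;>
    simp [Nmat, pow_succ] <;> field_simp <;> ring

lemma Nmat_tendsto (A B C : ℤ) (hA : 1 ≤ A) (hAB : A ≤ B) (hBC : B < C) (i j : Fin 3) :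
    Filter.Tendsto (fun n => ((Nmat A B C)^n) i j) Filter.atTop (nhds 0) := by
  have hC : (C : ℝ) ≠ 0 := by
    have : C ≠ 0 := by omega
    exact_mod_cast this
  apply abc_decay A B C (by exact_mod_cast hA) (by exact_mod_cast hAB) (by exact_mod_cast hBC)
  intro n
  have h := congrArg (fun X => ((Nmat A B C)^n * X) i j) (Nmat_cubic A B C hC)
  simp only [mul_add, Matrix.mul_smul, ← pow_add, ← pow_succ, mul_one, mul_zero,
    Matrix.add_apply, Matrix.smul_apply, Matrix.zero_apply, smul_eq_mul] at h
  exact h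

/-- Norm decay of `N^n z`, uniformly on the unit cube. -/
lemma Nmat_uniform (A B C : ℤ) (hA : 1 ≤ A) (hAB : A ≤ B) (hBC : B < C) (R : ℝ) (ε : ℝ)
    (hε : 0 < ε) : ∃ n : ℕ, ∀ z : Fin 3 → ℝ, (∀ i, |z i| ≤ R) →
      ∀ i, |((Nmat A B C)^n).mulVec z i| < ε := by
  have h : ∀ i, Filter.Tendsto (fun n => ∑ j, |((Nmat A B C)^n) i j| * R) Filter.atTop
      (nhds 0) := by
    intro i
    have : Filter.Tendsto (fun n => ∑ j, |((Nmat A B C)^n) i j| * R) Filter.atTop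
        (nhds (∑ j : Fin 3, |(0:ℝ)| * R)) :=
      tendsto_finsetSum _ fun j _ => ((Nmat_tendsto A B C hA hAB hBC i j).abs).mul_const R
    simpa using this
  have h2 : ∀ᶠ n in Filter.atTop, ∀ i, ∑ j, |((Nmat A B C)^n) i j| * R < ε :=
    Filter.eventually_all.2 fun i => (h i).eventually (gt_mem_nhds hε)
  obtain ⟨n, hn⟩ := h2.exists
  refine ⟨n, fun z hz i => lt_of_le_of_lt ?_ (hn i)⟩
  rw [Matrix.mulVec, dotProduct]
  refine (Finset.abs_sum_le_sum_abs _ _).trans (Finset.sum_le_sum fun j _ => ?_)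
  rw [abs_mul]
  exact mul_le_mul_of_nonneg_left (hz j) (abs_nonneg _)

/-- Integer action of `M`. -/
def gZ (A B C : ℤ) (x : Fin 3 → ℤ) : Fin 3 → ℤ := ![-C * x 2, x 0 - B * x 2, x 1 - A * x 2]

lemma toR_gZ (A B C : ℤ) (x : Fin 3 → ℤ) :
    toR (gZ A B C x) = (Mmat A B C).mulVec (toR x) := by
  ext i
  fin_cases i <;> simp [toR, gZ, Mmat, Matrix.mulVec, dotProduct, Fin.sum_univ_three] <;> ring

/-- Redundant four-digit states. -/
def phiZ (A B C : ℤ) (a : ℤ × ℤ × ℤ × ℤ) : Fin 3 → ℤ :=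
  ![a.1 - C * a.2.2.2, a.2.1 - B * a.2.2.2, a.2.2.1 - A * a.2.2.2]

def stepZ (A B C : ℤ) (a : ℤ × ℤ × ℤ × ℤ) : ℤ × ℤ × ℤ × ℤ :=
  (a.2.1 + (a.1 / C) * (C - B), a.2.2.1 + (a.1 / C) * (B - A), a.2.2.2 + (a.1/C) * (A - 1), a.1 / C)

lemma phi_step (A B C : ℤ) (a : ℤ × ℤ × ℤ × ℤ) :
    phiZ A B C a = gZ A B C (phiZ A B C (stepZ A B C a)) + ![a.1 % C, 0, 0] := by
  have := Int.emod_add_mul_ediv a.1 C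
  ext i
  fin_cases i
  · simp [phiZ, gZ, stepZ]; linarith
  · simp [phiZ, gZ, stepZ]; ring
  · simp [phiZ, gZ, stepZ]; ring

/-- The canonical number system induction principle. -/
lemma cns_induction (A B C : ℤ) (hA : 1 ≤ A) (hAB : A ≤ B) (hBC : B < C)
    (Q : (Fin 3 → ℤ) → Prop) (h0 : Q 0)
    (hstep : ∀ x r, 0 ≤ r → r < C → Q x → Q (gZ A B C x + ![r, 0, 0])) : ∀ x, Q x := by
  have hCpos : 0 < C := by omega
  have main : ∀ S : ℕ, ∀ a : ℤ × ℤ × ℤ × ℤ, 0 ≤ a.1 → 0 ≤ a.2.1 → 0 ≤ a.2.2.1 → 0 ≤ a.2.2.2 →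
      a.1 + a.2.1 + a.2.2.1 + a.2.2.2 = S → Q (phiZ A B C a) := by
    intro S
    induction S using Nat.strong_induction_on with
    | _ S ih =>
      intro a0 p0 p1 p2 p3 hsum
      by_contra hnot
      let Inv : ℤ × ℤ × ℤ × ℤ → Prop := fun a => 0 ≤ a.1 ∧ 0 ≤ a.2.1 ∧ 0 ≤ a.2.2.1 ∧
        0 ≤ a.2.2.2 ∧ a.1 + a.2.1 + a.2.2.1 + a.2.2.2 = S ∧ ¬ Q (phiZ A B C a)
      have hInv : ∀ a, Inv a → Inv (stepZ A B C a) ∧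
          phiZ A B C a = gZ A B C (phiZ A B C (stepZ A B C a)) := by
        rintro a ⟨q0, q1, q2, q3, hs, hn⟩
        have hr0 := Int.emod_nonneg a.1 hCpos.ne'
        have hr1 := Int.emod_lt_of_pos a.1 hCpos
        have hd := Int.emod_add_mul_ediv a.1 C
        have hq : 0 ≤ a.1 / C := Int.ediv_nonneg q0 hCpos.le
        have e := phi_step A B C a
        have hn' : ¬ Q (phiZ A B C (stepZ A B C a)) := fun h => hn (by
          rw [e]; exact hstep _ _ hr0 hr1 h)
        have s0 : 0 ≤ (stepZ A B C a).1 :=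
          add_nonneg q1 (mul_nonneg hq (by omega))
        have s1 : 0 ≤ (stepZ A B C a).2.1 :=
          add_nonneg q2 (mul_nonneg hq (by omega))
        have s2 : 0 ≤ (stepZ A B C a).2.2.1 :=
          add_nonneg q3 (mul_nonneg hq (by omega))
        have s3 : 0 ≤ (stepZ A B C a).2.2.2 := hq
        have hs' : (stepZ A B C a).1 + (stepZ A B C a).2.1 + (stepZ A B C a).2.2.1 +
            (stepZ A B C a).2.2.2 = S - a.1 % C := by
          simp only [stepZ]
          linarith
        have hr : a.1 % C = 0 := by
          by_contra hne
          have hpos : 0 < a.1 % C := lt_of_le_of_ne hr0 (Ne.symm hne)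
          exact hn' (ih (S - a.1 % C).toNat (by omega) _ s0 s1 s2 s3 (by omega))
        refine ⟨⟨s0, s1, s2, s3, by omega, hn'⟩, ?_⟩
        rw [hr] at e
        rw [e]
        ext i
        fin_cases i <;> simp
      let a : ℕ → ℤ × ℤ × ℤ × ℤ := fun n => (stepZ A B C)^[n] a0
      have hsucc : ∀ n, a (n+1) = stepZ A B C (a n) := fun n =>
        Function.iterate_succ_apply' _ _ _
      have hall : ∀ n, Inv (a n) := by
        intro n
        induction n with
        | zero => exact ⟨p0, p1, p2, p3, hsum, hnot⟩
        | succ n ihn => rw [hsucc]; exact (hInv _ ihn).1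
      have hC : (C : ℝ) ≠ 0 := by exact_mod_cast hCpos.ne'
      have hN : ∀ n, toR (phiZ A B C (a n)) =
          ((Nmat A B C)^n).mulVec (toR (phiZ A B C a0)) := by
        intro n
        induction n with
        | zero => simp [a]
        | succ n ihn =>
          have e := (hInv _ (hall n)).2
          rw [← hsucc] at e
          rw [pow_succ', ← Matrix.mulVec_mulVec, ← ihn, e, toR_gZ, Matrix.mulVec_mulVec,
            Nmat_mul_Mmat A B C hC, Matrix.one_mulVec]
      obtain ⟨n, hn⟩ := Nmat_uniform A B C hA hAB hBC (∑ i, |toR (phiZ A B C a0) i|) 1 one_pos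
      have hz := hn (toR (phiZ A B C a0)) (fun i =>
        Finset.single_le_sum (f := fun i => |toR (phiZ A B C a0) i|)
          (fun _ _ => abs_nonneg _) (Finset.mem_univ i))
      rw [← hN] at hz
      have : phiZ A B C (a n) = 0 := by
        ext i
        have := hz i
        simp only [toR] at this
        have h' : |phiZ A B C (a n) i| < 1 := by exact_mod_cast this
        exact Int.abs_lt_one_iff.mp h'
      exact (hall n).2.2.2.2.2 (this ▸ h0)
  intro x
  set k := |x 0| + |x 1| + |x 2| with hk
  have b0 := abs_nonneg (x 0)
  have b1 := abs_nonneg (x 1)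
  have b2 := abs_nonneg (x 2)
  have c0 := neg_abs_le (x 0)
  have c1 := neg_abs_le (x 1)
  have c2 := neg_abs_le (x 2)
  have hk0 : 0 ≤ k := by omega
  have d0 : k ≤ C * k := by nlinarith
  have d1 : k ≤ B * k := by nlinarith
  have d2 : k ≤ A * k := by nlinarith
  have := main (x 0 + C * k + (x 1 + B * k) + (x 2 + A * k) + k).toNat
    (x 0 + C * k, x 1 + B * k, x 2 + A * k, k) (by simp only; omega) (by simp only; omega)
    (by simp only; omega) hk0 (by simp only; omega)
  convert this using 1
  ext i
  fin_cases i <;> simp [phiZ]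

lemma vol_translate (v : Fin 3 → ℝ) (T : Set (Fin 3 → ℝ)) :
    volume (tileTranslate v T) = volume T := by
  rw [tileTranslate, Set.image_add_right, measure_preimage_add_right]

lemma mem_translate (v x : Fin 3 → ℝ) (T : Set (Fin 3 → ℝ)) :
    x ∈ tileTranslate v T ↔ x - v ∈ T := by
  simp [tileTranslate, sub_eq_add_neg]

lemma toR_add (x y : Fin 3 → ℤ) : toR (x + y) = toR x + toR y := by
  ext i; simp [toR]

lemma det_Mmat (A B C : ℤ) : (Mmat A B C).det = -C := by
  simp [Mmat, Matrix.det_fin_three]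

lemma vol_Mmat (A B C : ℤ) (hC : 0 ≤ C) (S : Set (Fin 3 → ℝ)) :
    volume ((Mmat A B C).mulVec '' S) = ENNReal.ofReal C * volume S := by
  have h := MeasureTheory.Measure.addHaar_image_linearMap (volume : Measure (Fin 3 → ℝ))
    (Matrix.toLin' (Mmat A B C)) S
  rw [LinearMap.det_toLin', det_Mmat, abs_neg, abs_of_nonneg (by exact_mod_cast hC)] at h
  rw [← h]
  rfl

/-- First-level essential disjointness. -/
lemma first_level (A B C : ℤ) (T : Set (Fin 3 → ℝ)) (hT : IsABCTile A B C T)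
    (r : ℤ) (hr0 : 0 < r) (hrC : r < C) :
    volume (T ∩ tileTranslate (toR ![r, 0, 0]) T) = 0 := by
  obtain ⟨hA, hAB, hBC, -, hcomp, -, hset⟩ := hT
  have hfin : volume T ≠ ⊤ := hcomp.measure_lt_top.ne
  let f : ℕ → Set (Fin 3 → ℝ) := fun i => tileTranslate (toR ![(i : ℤ), 0, 0]) T
  have hf0 : f 0 = T := by
    have : toR ![((0:ℕ) : ℤ), 0, 0] = 0 := by
      ext i; fin_cases i <;> simp [toR]
    simp only [f, this]
    simp [tileTranslate]
  have hmeas : MeasurableSet (f r.toNat) := by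
    simp only [f, tileTranslate]
    exact (hcomp.image (by fun_prop)).measurableSet
  have hfr : f r.toNat = tileTranslate (toR ![r, 0, 0]) T := by
    simp only [f]
    rw [Int.toNat_of_nonneg hr0.le]
  have hvol : ∀ i, volume (f i) = volume T := fun i => vol_translate _ _
  let s := ((Finset.range C.toNat).erase 0).erase r.toNat
  have hscard : s.card + 2 = C.toNat := by
    have h1 : r.toNat ∈ (Finset.range C.toNat).erase 0 := by
      simp; omega
    have h2 : 0 ∈ Finset.range C.toNat := by simp; omega
    have e1 := Finset.card_erase_add_one h1
    have e2 := Finset.card_erase_add_one h2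
    rw [Finset.card_range] at e2
    simp only [s]
    omega
  have hsub : (Mmat A B C).mulVec '' T ⊆ (f 0 ∪ f r.toNat) ∪ ⋃ i ∈ s, f i := by
    rw [hset]
    intro x hx
    simp only [Set.mem_iUnion] at hx
    obtain ⟨d, ⟨i, hi0, hiC, rfl⟩, hx⟩ := hx
    have hx' : x ∈ f i.toNat := by
      simp only [f]
      rw [Int.toNat_of_nonneg hi0]
      convert hx using 2
      ext j; fin_cases j <;> simp [toR]
    by_cases h1 : i.toNat = 0
    · left; left; rwa [h1] at hx'
    by_cases h2 : i.toNat = r.toNat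
    · left; right; rwa [h2] at hx'
    right
    simp only [Set.mem_iUnion]
    refine ⟨i.toNat, ?_, hx'⟩
    simp [s, h1, h2]; omega
  have hle := (measure_mono hsub).trans (measure_union_le (μ := volume) _ _)
  have hle2 : volume (⋃ i ∈ s, f i) ≤ s.card * volume T := by
    refine (measure_biUnion_finset_le s f).trans ?_
    simp [hvol]
  have hie := measure_union_add_inter (μ := volume) (f 0) hmeas
  rw [hvol, hvol] at hie
  rw [vol_Mmat A B C (by omega)] at hle
  have hCc : ENNReal.ofReal (C : ℝ) = (s.card : ENNReal) + 2 := by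
    have : (C : ℝ) = ((s.card + 2 : ℕ) : ℝ) := by
      rw [hscard]
      have : ((C.toNat : ℤ) : ℝ) = (C : ℝ) := by rw [Int.toNat_of_nonneg (by omega)]
      exact_mod_cast this.symm
    rw [this, ENNReal.ofReal_natCast]
    push_cast
    rfl
  rw [hCc] at hle
  rw [← hfr]
  nth_rewrite 1 [← hf0]
  set I := volume (f 0 ∩ f r.toNat)
  have hbig : ((s.card : ENNReal) + 2) * volume T + I ≤ ((s.card : ENNReal) + 2) * volume T + 0 := by
    calc ((s.card : ENNReal) + 2) * volume T + I
        ≤ (volume (f 0 ∪ f r.toNat) + volume (⋃ i ∈ s, f i)) + I := by gcongr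
      _ = (volume (f 0 ∪ f r.toNat) + I) + volume (⋃ i ∈ s, f i) := by ring
      _ ≤ (volume T + volume T) + s.card * volume T := by rw [hie]; gcongr
      _ = ((s.card : ENNReal) + 2) * volume T + 0 := by ring
  have hne : ((s.card : ENNReal) + 2) * volume T ≠ ⊤ :=
    ENNReal.mul_ne_top (by simp) hfin
  have := (ENNReal.add_le_add_iff_left hne).mp hbig
  exact le_antisymm this (zero_le)

/-- The inclusion of a translate in the inflated tile. -/
lemma sub_inflate (A B C : ℤ) (T : Set (Fin 3 → ℝ)) (hT : IsABCTile A B C T)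
    (x : Fin 3 → ℤ) (r : ℤ) (hr0 : 0 ≤ r) (hrC : r < C) :
    tileTranslate (toR (gZ A B C x + ![r, 0, 0])) T ⊆
      (Mmat A B C).mulVec '' tileTranslate (toR x) T := by
  obtain ⟨-, -, -, -, -, -, hset⟩ := hT
  rintro _ ⟨t, ht, rfl⟩
  have : t + toR ![r, 0, 0] ∈ (Mmat A B C).mulVec '' T := by
    rw [hset]
    simp only [Set.mem_iUnion]
    refine ⟨toR ![r, 0, 0], ⟨r, hr0, hrC, ?_⟩, t, ht, rfl⟩
    ext j; fin_cases j <;> simp [toR]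
  obtain ⟨u, hu, hue⟩ := this
  refine ⟨u + toR x, ⟨u, hu, rfl⟩, ?_⟩
  rw [Matrix.mulVec_add, hue, toR_add, toR_gZ]
  simp only [add_assoc, add_comm (toR ![r, 0, 0])]

lemma tile_disjoint (A B C : ℤ) (T : Set (Fin 3 → ℝ)) (hT : IsABCTile A B C T) (α : Fin 3 → ℤ) :
    α = 0 ∨ volume (T ∩ tileTranslate (toR α) T) = 0 := by
  have hT' := hT
  obtain ⟨hA, hAB, hBC, -, -, -, -⟩ := hT'
  have hC : (C : ℝ) ≠ 0 := by
    have : C ≠ 0 := by omega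
    exact_mod_cast this
  refine cns_induction A B C hA hAB hBC
    (fun α => α = 0 ∨ volume (T ∩ tileTranslate (toR α) T) = 0) (Or.inl rfl) ?_ α
  intro x r hr0 hrC hx
  have hg0 : gZ A B C 0 = 0 := by
    ext i; fin_cases i <;> simp [gZ]
  have h00 : (![0, 0, 0] : Fin 3 → ℤ) = 0 := by
    ext i; fin_cases i <;> simp
  rcases hx with rfl | hx
  · rw [hg0, zero_add]
    rcases hr0.eq_or_lt with rfl | hr
    · left; exact h00
    · right; exact first_level A B C T hT r hr hrC
  · right
    have s1 := sub_inflate A B C T hT x r hr0 hrC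
    have s2 := sub_inflate A B C T hT 0 0 le_rfl (by omega)
    have e0 : tileTranslate (toR 0) T = T := by
      have : toR 0 = 0 := by ext i; simp [toR]
      rw [this]; simp [tileTranslate]
    rw [hg0, h00, zero_add, e0] at s2
    have hinj : Function.Injective (Mmat A B C).mulVec := by
      intro u v huv
      have := congrArg (Nmat A B C).mulVec huv
      simpa [Matrix.mulVec_mulVec, Nmat_mul_Mmat A B C hC] using this
    refine measure_mono_null (Set.inter_subset_inter s2 s1) ?_
    rw [← Set.image_inter hinj, vol_Mmat A B C (by omega), hx, mul_zero]

lemma tile_cover (A B C : ℤ) (T : Set (Fin 3 → ℝ)) (hT : IsABCTile A B C T) :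
    (⋃ α : Fin 3 → ℤ, tileTranslate (toR α) T) = Set.univ := by
  have hT' := hT
  obtain ⟨hA, hAB, hBC, ⟨t, ht⟩, hcomp, -, hset⟩ := hT'
  have hCpos : 0 < C := by omega
  have hC : (C : ℝ) ≠ 0 := by exact_mod_cast hCpos.ne'
  set E := ⋃ α : Fin 3 → ℤ, tileTranslate (toR α) T with hE
  have memE : ∀ x, x ∈ E ↔ ∃ α : Fin 3 → ℤ, x - toR α ∈ T := by
    intro x; simp [hE, mem_translate]
  -- invariance of E under the inverse map
  have hNE : ∀ x ∈ E, (Nmat A B C).mulVec x ∈ E := by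
    intro x hx
    obtain ⟨α, hα⟩ := (memE x).1 hx
    let y : Fin 3 → ℤ := ![α 1 + B * (-(α 0 / C)), α 2 + A * (-(α 0 / C)), -(α 0 / C)]
    have hy : α = gZ A B C y + ![α 0 % C, 0, 0] := by
      have := Int.emod_add_mul_ediv (α 0) C
      ext i; fin_cases i
      · simp [gZ, y]; linarith
      · simp [gZ, y]
      · simp [gZ, y]
    have hs := sub_inflate A B C T hT y (α 0 % C) (Int.emod_nonneg _ hCpos.ne')
      (Int.emod_lt_of_pos _ hCpos)
    rw [← hy] at hs
    obtain ⟨u, hu, rfl⟩ := hs ((mem_translate _ _ _).2 hα)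
    rw [Matrix.mulVec_mulVec, Nmat_mul_Mmat A B C hC, Matrix.one_mulVec]
    exact Set.mem_iUnion.2 ⟨y, hu⟩
  have hNnE : ∀ n : ℕ, ∀ x ∈ E, ((Nmat A B C)^n).mulVec x ∈ E := by
    intro n
    induction n with
    | zero => intro x hx; simpa using hx
    | succ n ih =>
      intro x hx
      rw [pow_succ, ← Matrix.mulVec_mulVec]
      exact ih _ (hNE x hx)
  have hdense : ∀ x : Fin 3 → ℝ, ∀ ε > 0, ∃ y ∈ E, ∀ i, |y i - x i| < ε := by
    intro x ε hε
    obtain ⟨n, hn⟩ := Nmat_uniform A B C hA hAB hBC 1 ε hε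
    set w := ((Mmat A B C)^n).mulVec x with hw
    have hNw : ((Nmat A B C)^n).mulVec w = x := by
      have hc : Commute (Nmat A B C) (Mmat A B C) := by
        rw [Commute, SemiconjBy, Nmat_mul_Mmat A B C hC, Mmat_mul_Nmat A B C hC]
      rw [hw, Matrix.mulVec_mulVec, ← hc.mul_pow, Nmat_mul_Mmat A B C hC, one_pow,
        Matrix.one_mulVec]
    let α : Fin 3 → ℤ := fun i => ⌊w i - t i⌋
    have hv : t + toR α ∈ E := (memE _).2 ⟨α, by simpa using ht⟩
    refine ⟨_, hNnE n _ hv, fun i => ?_⟩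
    have hz := hn (t + toR α - w) (fun i => by
      have h1 := Int.floor_le (w i - t i)
      have h2 := Int.lt_floor_add_one (w i - t i)
      simp only [Pi.sub_apply, Pi.add_apply, toR, α]
      rw [abs_le]
      constructor <;> linarith) i
    rw [Matrix.mulVec_sub, hNw] at hz
    exact hz
  -- closedness: locally finite argument through compactness
  have hclosed : IsClosed E := by
    rw [hE]
    refine LocallyFinite.isClosed_iUnion ?_ ?_
    · intro x
      refine ⟨Metric.ball x 1, Metric.ball_mem_nhds x one_pos, ?_⟩
      obtain ⟨R, hR⟩ := hcomp.isBounded.exists_norm_le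
      let L : ℤ := ⌈‖x‖ + 1 + R⌉
      refine (Set.finite_Icc (fun _ : Fin 3 => -L) (fun _ => L)).subset ?_
      rintro α ⟨y, hy1, hy2⟩
      rw [mem_translate] at hy1
      have n1 := hR _ hy1
      have n2 : ‖y‖ ≤ ‖x‖ + 1 := by
        have h3 : ‖y - x‖ < 1 := by simpa [dist_eq_norm] using hy2
        have h4 : ‖y‖ ≤ ‖x‖ + ‖y - x‖ := by
          calc ‖y‖ = ‖x + (y - x)‖ := by congr 1; simp
            _ ≤ _ := norm_add_le _ _
        linarith
      have n3 : ‖toR α‖ ≤ ‖x‖ + 1 + R := by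
        calc ‖toR α‖ = ‖y - (y - toR α)‖ := by congr 1; simp
          _ ≤ ‖y‖ + ‖y - toR α‖ := norm_sub_le _ _
          _ ≤ _ := by linarith
      have hb : ∀ i, |α i| ≤ L := by
        intro i
        have h5 : |(α i : ℝ)| ≤ ‖toR α‖ := norm_le_pi_norm (toR α) i
        have h6 := Int.le_ceil (‖x‖ + 1 + R)
        have : ((|α i| : ℤ) : ℝ) ≤ (L : ℝ) := by
          push_cast
          linarith
        exact_mod_cast this
      exact ⟨fun i => (abs_le.mp (hb i)).1, fun i => (abs_le.mp (hb i)).2⟩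
    · intro α
      exact (hcomp.image (by fun_prop)).isClosed
  have hd : Dense E := by
    intro x
    rw [Metric.mem_closure_iff]
    intro ε hε
    obtain ⟨y, hy, hyx⟩ := hdense x ε hε
    refine ⟨y, hy, ?_⟩
    rw [dist_comm, dist_pi_lt_iff hε]
    exact fun i => by rw [Real.dist_eq]; exact hyx i
  rw [← hclosed.closure_eq, hd.closure_eq]

theorem stmt1 (A B C : ℤ) (T : Set (Fin 3 → ℝ)) (hT : IsABCTile A B C T) :
    (⋃ α : Fin 3 → ℤ, tileTranslate (toR α) T) = Set.univ ∧
    (∀ α₁ α₂ : Fin 3 → ℤ, α₁ ≠ α₂ →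
      volume (tileTranslate (toR α₁) T ∩ tileTranslate (toR α₂) T) = 0) := by
  refine ⟨tile_cover A B C T hT, fun α₁ α₂ hne => ?_⟩
  have h := (tile_disjoint A B C T hT (α₂ - α₁)).resolve_left
    (fun h => hne (sub_eq_zero.1 h).symm)
  rw [← vol_translate (toR α₁)] at h
  refine measure_mono_null ?_ h
  rintro x ⟨h1, h2⟩
  rw [mem_translate] at h1 h2 ⊢
  refine ⟨h1, ?_⟩
  rw [mem_translate]
  convert h2 using 1
  ext i
  simp [toR]
end

section
/- Let T be an ABC-tile. Then T has exactly 14 neighbors if and only if A, B, C satisfy one of the following two conditions: (1) 1 ≤ A < B < C, B ≥ 2A − 1, and C ≥ 2(B − A) + 2; (2) 1 ≤ A < B < C, B < 2A − 1, and C ≥ A + B − 2. -/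
open MeasureTheory

def Cnd (A B C : ℤ) : Prop := ((1 ≤ A ∧ A < B ∧ B < C ∧ 2 * A - 1 ≤ B ∧ 2 * (B - A) + 2 ≤ C) ∨
       (1 ≤ A ∧ A < B ∧ B < C ∧ B < 2 * A - 1 ∧ A + B - 2 ≤ C))

/-- admissible integer sequences -/
def Ok (A B C : ℤ) (z : ℕ → ℤ) : Prop :=
  ∀ k, -(C - 1) ≤ z (k+3) + A * z (k+2) + B * z (k+1) + C * z k ∧
    z (k+3) + A * z (k+2) + B * z (k+1) + C * z k ≤ C - 1

theorem tree2 (A B C : ℤ) (z : ℕ → ℤ) (hc : Cnd A B C) (h : Ok A B C z)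
    (hb : ∀ k, -2 ≤ z k ∧ z k ≤ 2) (h0 : z 0 = 2) : False := by
  unfold Cnd at hc
  have e0 := h 0
  have e1 := h 1
  have e2 := h 2
  have e3 := h 3
  have e4 := h 4
  have e5 := h 5
  have b1 := hb 1
  have b2 := hb 2
  have b3 := hb 3
  have b4 := hb 4
  have b5 := hb 5
  have b6 := hb 6
  have b7 := hb 7
  have b8 := hb 8
  norm_num at e0 e1 e2 e3 e4 e5
  clear hb h
  generalize z 0 = a0 at *
  generalize z 1 = a1 at *
  generalize z 2 = a2 at *
  generalize z 3 = a3 at *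
  generalize z 4 = a4 at *
  generalize z 5 = a5 at *
  generalize z 6 = a6 at *
  generalize z 7 = a7 at *
  generalize z 8 = a8 at *
  subst h0
  obtain ⟨b1, b1'⟩ := b1
  obtain ⟨b2, b2'⟩ := b2
  interval_cases a1 <;> interval_cases a2 <;> try (clear e1 e2 e3 e4 e5; omega)
  all_goals
    obtain ⟨b3, b3'⟩ := b3
    interval_cases a3 <;> try (clear e2 e3 e4 e5; omega)
  all_goals
    obtain ⟨b4, b4'⟩ := b4
    interval_cases a4 <;> try (clear e3 e4 e5; omega)
  all_goals
    obtain ⟨b5, b5'⟩ := b5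
    interval_cases a5 <;> try (clear e4 e5; omega)
  all_goals
    obtain ⟨b6, b6'⟩ := b6
    interval_cases a6 <;> try (clear e5; omega)
  all_goals
    obtain ⟨b7, b7'⟩ := b7
    interval_cases a7 <;> omega

theorem tree3 (A B C : ℤ) (z : ℕ → ℤ) (hc : Cnd A B C) (h : Ok A B C z)
    (hb : ∀ k, -3 ≤ z k ∧ z k ≤ 3) (h0 : z 0 = 3) : False := by
  unfold Cnd at hc
  have e0 := h 0
  have e1 := h 1
  have e2 := h 2
  have b1 := hb 1
  have b2 := hb 2
  have b3 := hb 3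
  have b4 := hb 4
  have b5 := hb 5
  norm_num at e0 e1 e2
  clear hb h
  generalize z 0 = a0 at *
  generalize z 1 = a1 at *
  generalize z 2 = a2 at *
  generalize z 3 = a3 at *
  generalize z 4 = a4 at *
  generalize z 5 = a5 at *
  subst h0
  obtain ⟨b1, b1'⟩ := b1
  obtain ⟨b2, b2'⟩ := b2
  interval_cases a1 <;> interval_cases a2 <;> try (clear e1 e2; omega)
  all_goals
    obtain ⟨b3, b3'⟩ := b3
    interval_cases a3 <;> try (clear e2; omega)
  all_goals
    obtain ⟨b4, b4'⟩ := b4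
    interval_cases a4 <;> omega

/-- alternating words -/
def Alt (a b c : ℤ) : Prop :=
  a + b ≤ 1 ∧ -1 ≤ a + b ∧ b + c ≤ 1 ∧ -1 ≤ b + c ∧ a + b + c ≤ 1 ∧ -1 ≤ a + b + c

theorem tree1 (A B C : ℤ) (z : ℕ → ℤ) (hc : Cnd A B C) (h : Ok A B C z)
    (hb : ∀ k, -1 ≤ z k ∧ z k ≤ 1) : Alt (z 0) (z 1) (z 2) := by
  unfold Cnd at hc
  unfold Alt
  have e0 := h 0
  have e1 := h 1
  have e2 := h 2
  have e3 := h 3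
  have e4 := h 4
  have b0 := hb 0
  have b1 := hb 1
  have b2 := hb 2
  have b3 := hb 3
  have b4 := hb 4
  have b5 := hb 5
  have b6 := hb 6
  have b7 := hb 7
  norm_num at e0 e1 e2 e3 e4
  clear hb h
  generalize z 0 = a0 at *
  generalize z 1 = a1 at *
  generalize z 2 = a2 at *
  generalize z 3 = a3 at *
  generalize z 4 = a4 at *
  generalize z 5 = a5 at *
  generalize z 6 = a6 at *
  generalize z 7 = a7 at *
  obtain ⟨b0, b0'⟩ := b0
  obtain ⟨b1, b1'⟩ := b1
  obtain ⟨b2, b2'⟩ := b2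
  interval_cases a0 <;> interval_cases a1 <;> interval_cases a2 <;> try (clear e1 e2 e3 e4; omega)
  all_goals
    exfalso
    obtain ⟨b3, b3'⟩ := b3
    interval_cases a3 <;> (clear e2 e3 e4; omega)

theorem mul_bd (c z K : ℤ) (h : -K ≤ z ∧ z ≤ K) : -(max c (-c) * K) ≤ c * z := by
  have h1 : |z| ≤ K := abs_le.2 h
  have h2 : |c| = max c (-c) := rfl
  rw [← h2]
  have := neg_abs_le (c * z)
  rw [abs_mul] at this
  nlinarith [mul_le_mul_of_nonneg_left h1 (abs_nonneg c)]

theorem cover (A B C : ℤ) (hc : Cnd A B C) :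
    2 * (C - 1) + (C - 1) < 4 * (2 * C - max (2 * B - C) (-(2 * B - C))
       - max (2 * A - B) (-(2 * A - B)) - max (2 - A) (-(2 - A)) - 1) ∨
    8 * (C - 1) < 4 * (4 * C - max (4 * B - 3 * C) (-(4 * B - 3 * C))
       - max (4 * A - 3 * B + C) (-(4 * A - 3 * B + C)) - max (4 - 3 * A + B) (-(4 - 3 * A + B))
       - max (A - 3) (-(A - 3)) - 1) ∨
    5 * (C - 1) < 4 * (3 * C - max (3 * B - 2 * C) (-(3 * B - 2 * C))
       - max (3 * A - 2 * B) (-(3 * A - 2 * B)) - max (3 - 2 * A) (-(3 - 2 * A)) - 2) := by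
  unfold Cnd at hc
  omega

theorem big (A B C K : ℤ) (z : ℕ → ℤ) (hc : Cnd A B C) (h : Ok A B C z) (hK : 4 ≤ K)
    (hb : ∀ k, -K ≤ z k ∧ z k ≤ K) (h0 : z 0 = K) : False := by
  have e0 := h 0
  have e1 := h 1
  have e2 := h 2
  norm_num at e0 e1 e2
  rw [h0] at e0
  rcases cover A B C hc with hX | hX | hX
  · have t1 := mul_bd (2 * B - C) (z 1) K (hb 1)
    have t2 := mul_bd (2 * A - B) (z 2) K (hb 2)
    have t3 := mul_bd (2 - A) (z 3) K (hb 3)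
    have t4 := hb 4
    generalize max (2 * B - C) (-(2 * B - C)) = m1 at *
    generalize max (2 * A - B) (-(2 * A - B)) = m2 at *
    generalize max (2 - A) (-(2 - A)) = m3 at *
    have hC : 0 ≤ C - 1 := by unfold Cnd at hc; omega
    have hY : K * (2 * C - m1 - m2 - m3 - 1) ≤ 3 * (C - 1) := by nlinarith
    nlinarith
  · have t1 := mul_bd (4 * B - 3 * C) (z 1) K (hb 1)
    have t2 := mul_bd (4 * A - 3 * B + C) (z 2) K (hb 2)
    have t3 := mul_bd (4 - 3 * A + B) (z 3) K (hb 3)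
    have t4 := mul_bd (A - 3) (z 4) K (hb 4)
    have t5 := hb 5
    generalize max (4 * B - 3 * C) (-(4 * B - 3 * C)) = m1 at *
    generalize max (4 * A - 3 * B + C) (-(4 * A - 3 * B + C)) = m2 at *
    generalize max (4 - 3 * A + B) (-(4 - 3 * A + B)) = m3 at *
    generalize max (A - 3) (-(A - 3)) = m4 at *
    have hC : 0 ≤ C - 1 := by unfold Cnd at hc; omega
    have hY : K * (4 * C - m1 - m2 - m3 - m4 - 1) ≤ 8 * (C - 1) := by nlinarith
    nlinarith
  · have t1 := mul_bd (3 * B - 2 * C) (z 1) K (hb 1)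
    have t2 := mul_bd (3 * A - 2 * B) (z 2) K (hb 2)
    have t3 := mul_bd (3 - 2 * A) (z 3) K (hb 3)
    have t4 := hb 4
    generalize max (3 * B - 2 * C) (-(3 * B - 2 * C)) = m1 at *
    generalize max (3 * A - 2 * B) (-(3 * A - 2 * B)) = m2 at *
    generalize max (3 - 2 * A) (-(3 - 2 * A)) = m3 at *
    have hC : 0 ≤ C - 1 := by unfold Cnd at hc; omega
    have hY : K * (3 * C - m1 - m2 - m3 - 2) ≤ 5 * (C - 1) := by nlinarith
    nlinarith

theorem upper (A B C R : ℤ) (z : ℕ → ℤ) (hc : Cnd A B C) (h : Ok A B C z)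
    (hb : ∀ k, |z k| ≤ R) : ∀ k, |z k| ≤ 1 := by
  classical
  -- the maximum of `|z k|` is attained
  obtain ⟨n, hn⟩ : ∃ n, ∀ k, |z k| ≤ |z n| := by
    have hfin : (Set.range fun k => |z k|).Finite :=
      (Set.finite_Icc 0 R).subset (by
        rintro _ ⟨k, rfl⟩
        exact ⟨abs_nonneg _, hb k⟩)
    obtain ⟨_, ⟨n, rfl⟩, hn⟩ := Set.exists_max_image _ id hfin ⟨_, ⟨0, rfl⟩⟩
    exact ⟨n, fun k => hn _ ⟨k, rfl⟩⟩
  obtain ⟨w, hw, hw0, hwb⟩ : ∃ w : ℕ → ℤ, Ok A B C w ∧ w 0 = |z n| ∧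
      ∀ k, -|z n| ≤ w k ∧ w k ≤ |z n| := by
    rcases le_total 0 (z n) with hs | hs
    · refine ⟨fun k => z (n + k), fun k => ?_, (abs_of_nonneg hs).symm, fun k => ?_⟩
      · exact h (n + k)
      · exact abs_le.1 (hn _)
    · refine ⟨fun k => -z (n + k), fun k => ?_, (abs_of_nonpos hs).symm, fun k => ?_⟩
      · have := h (n + k)
        simp only [← add_assoc]
        constructor <;> linarith [this.1, this.2]
      · have := abs_le.1 (hn (n + k))
        dsimp only
        constructor <;> linarith [this.1, this.2]
  intro k
  refine (hn k).trans ?_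
  by_contra hcon
  generalize |z n| = K at *
  have : 2 ≤ K := by omega
  rcases lt_or_ge K 4 with h4 | h4
  · interval_cases K
    · exact tree2 A B C w hc hw hwb hw0
    · exact tree3 A B C w hc hw hwb hw0
  · exact big A B C K w hc hw h4 hwb hw0

theorem upper_alt (A B C R : ℤ) (z : ℕ → ℤ) (hc : Cnd A B C) (h : Ok A B C z)
    (hb : ∀ k, |z k| ≤ R) : (|z 0| ≤ 1 ∧ |z 1| ≤ 1 ∧ |z 2| ≤ 1) ∧ Alt (z 0) (z 1) (z 2) := by
  have := upper A B C R z hc h hb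
  exact ⟨⟨this 0, this 1, this 2⟩, tree1 A B C z hc h fun k => abs_le.1 (this k)⟩

/-- triples which extend to a bounded admissible sequence -/
def BExt (A B C : ℤ) (a b c : ℤ) : Prop :=
  ∃ (z : ℕ → ℤ) (R : ℤ), Ok A B C z ∧ (∀ k, |z k| ≤ R) ∧ z 0 = a ∧ z 1 = b ∧ z 2 = c

/-- the constraint on four consecutive entries -/
def Bd (A B C a b c d : ℤ) : Prop :=
  -(C - 1) ≤ d + A * c + B * b + C * a ∧ d + A * c + B * b + C * a ≤ C - 1

theorem ext_per (A B C : ℤ) (n : ℕ) (hn : 0 < n) (f : ℕ → ℤ) (hf : ∀ k, f (k + n) = f k)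
    (h : ∀ k < n, Bd A B C (f k) (f (k+1)) (f (k+2)) (f (k+3))) :
    BExt A B C (f 0) (f 1) (f 2) := by
  have hm : ∀ k m, f (k + n * m) = f k := by
    intro k m
    induction m with
    | zero => simp
    | succ m ih => rw [Nat.mul_succ, ← add_assoc, hf, ih]
  refine ⟨f, ∑ i ∈ Finset.range n, |f i|, fun k => ?_, fun k => ?_, rfl, rfl, rfl⟩
  · have := h (k % n) (Nat.mod_lt _ hn)
    have e : ∀ j, f (k + j) = f (k % n + j) := by
      intro j
      conv_lhs => rw [← Nat.mod_add_div k n]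
      rw [add_right_comm, hm]
    have e0 := e 0
    simp only [add_zero] at e0
    rw [e 3, e 2, e 1, e0]
    exact this
  · have e : f k = f (k % n) := by
      conv_lhs => rw [← Nat.mod_add_div k n]
      rw [hm]
    rw [e]
    exact Finset.single_le_sum (f := fun i => |f i|) (fun i _ => abs_nonneg _)
      (Finset.mem_range.2 (Nat.mod_lt _ hn))

theorem ext4 (A B C a b c d : ℤ) (h0 : Bd A B C a b c d) (h1 : Bd A B C b c d a)
    (h2 : Bd A B C c d a b) (h3 : Bd A B C d a b c) : BExt A B C a b c := by
  refine ext_per A B C 4 (by norm_num)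
    (fun k => if k % 4 = 0 then a else if k % 4 = 1 then b else if k % 4 = 2 then c else d)
    (fun k => by simp) ?_
  intro k hk
  interval_cases k <;> simpa

theorem ext6 (A B C a b c d e f : ℤ) (h0 : Bd A B C a b c d) (h1 : Bd A B C b c d e)
    (h2 : Bd A B C c d e f) (h3 : Bd A B C d e f a) (h4 : Bd A B C e f a b)
    (h5 : Bd A B C f a b c) : BExt A B C a b c := by
  refine ext_per A B C 6 (by norm_num)
    (fun k => if k % 6 = 0 then a else if k % 6 = 1 then b else if k % 6 = 2 then c else
      if k % 6 = 3 then d else if k % 6 = 4 then e else f)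
    (fun k => by simp) ?_
  intro k hk
  interval_cases k <;> simpa

theorem lower (A B C a b c : ℤ) (hA : 1 ≤ A) (hB : A ≤ B) (hC : B < C)
    (ha : |a| ≤ 1) (hb : |b| ≤ 1) (hc : |c| ≤ 1) (h : Alt a b c) : BExt A B C a b c := by
  rw [abs_le] at ha hb hc
  obtain ⟨ha, ha'⟩ := ha
  obtain ⟨hb, hb'⟩ := hb
  obtain ⟨hc, hc'⟩ := hc
  unfold Alt at h
  interval_cases a <;> interval_cases b <;> interval_cases c <;> first
    | (exfalso; omega)
    | (apply ext4 A B C _ _ _ 0 <;> unfold Bd <;> omega)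
    | (apply ext4 A B C _ _ _ 1 <;> unfold Bd <;> omega)
    | (apply ext4 A B C _ _ _ (-1) <;> unfold Bd <;> omega)

theorem extra (A B C : ℤ) (hA : 1 ≤ A) (hB : A ≤ B) (hC : B < C) (hn : ¬ Cnd A B C) :
    ∃ a b c, ¬ ((|a| ≤ 1 ∧ |b| ≤ 1 ∧ |c| ≤ 1) ∧ Alt a b c) ∧ BExt A B C a b c := by
  unfold Cnd at hn
  rcases eq_or_lt_of_le hB with hAB | hAB
  · refine ⟨1, 1, -1, by unfold Alt; omega, ?_⟩
    apply ext4 A B C _ _ _ (-1) <;> unfold Bd <;> omega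
  · by_cases h2 : C ≤ 2 * (B - A) + 1
    · refine ⟨2, -2, 2, by norm_num, ?_⟩
      apply ext4 A B C _ _ _ (-2) <;> unfold Bd <;> omega
    · refine ⟨2, -1, -1, by norm_num, ?_⟩
      apply ext6 A B C _ _ _ 2 (-1) (-1) <;> unfold Bd <;> omega

theorem mulVec_eq (A B C : ℤ) (v : Fin 3 → ℝ) :
    (Mmat A B C).mulVec v = ![-(C * v 2), v 0 - B * v 2, v 1 - A * v 2] := by
  unfold Mmat
  ext i
  fin_cases i <;> simp [Matrix.mulVec, dotProduct, Fin.sum_univ_three] <;> ring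

/-- the set equation, read forwards -/
theorem tile_step {A B C : ℤ} {T : Set (Fin 3 → ℝ)} (hT : IsABCTile A B C T)
    {t : Fin 3 → ℝ} (ht : t ∈ T) : ∃ s ∈ T, ∃ i : ℤ, 0 ≤ i ∧ i < C ∧
      -(C * t 2) = s 0 + i ∧ t 0 - B * t 2 = s 1 ∧ t 1 - A * t 2 = s 2 := by
  have he := hT.2.2.2.2.2.2
  have hm : (Mmat A B C).mulVec t ∈ ⋃ d ∈ Ddig C, tileTranslate d T := he ▸ ⟨t, ht, rfl⟩
  simp only [Set.mem_iUnion] at hm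
  obtain ⟨d, ⟨i, hi0, hi1, rfl⟩, s, hs, hst⟩ := hm
  refine ⟨s, hs, i, hi0, hi1, ?_⟩
  rw [mulVec_eq] at hst
  have h0 := congrFun hst 0
  have h1 := congrFun hst 1
  have h2 := congrFun hst 2
  simp at h0 h1 h2
  exact ⟨h0.symm, h1.symm, h2.symm⟩

/-- the set equation, read backwards -/
theorem tile_back {A B C : ℤ} {T : Set (Fin 3 → ℝ)} (hT : IsABCTile A B C T)
    {s : Fin 3 → ℝ} (hs : s ∈ T) (i : ℤ) (hi0 : 0 ≤ i) (hi1 : i < C) : ∃ t ∈ T,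
      -(C * t 2) = s 0 + i ∧ t 0 - B * t 2 = s 1 ∧ t 1 - A * t 2 = s 2 := by
  have he := hT.2.2.2.2.2.2
  have hm : s + ![(i : ℝ), 0, 0] ∈ ⋃ d ∈ Ddig C, tileTranslate d T := by
    simp only [Set.mem_iUnion]
    exact ⟨_, ⟨i, hi0, hi1, rfl⟩, s, hs, rfl⟩
  rw [← he] at hm
  obtain ⟨t, ht, hst⟩ := hm
  refine ⟨t, ht, ?_⟩
  rw [mulVec_eq] at hst
  have h0 := congrFun hst 0
  have h1 := congrFun hst 1
  have h2 := congrFun hst 2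
  simp at h0 h1 h2
  exact ⟨h0, h1, h2⟩

theorem tile_bdd {A B C : ℤ} {T : Set (Fin 3 → ℝ)} (hT : IsABCTile A B C T) :
    ∃ R : ℝ, ∀ t ∈ T, ∀ i, |t i| ≤ R := by
  obtain ⟨R, hR⟩ := hT.2.2.2.2.1.isBounded.exists_norm_le
  exact ⟨R, fun t ht i => (norm_le_pi_norm t i).trans (hR t ht)⟩

theorem nb_to_ext {A B C : ℤ} {T : Set (Fin 3 → ℝ)} (hT : IsABCTile A B C T)
    (α : Fin 3 → ℤ) (t t' : Fin 3 → ℝ) (ht : t ∈ T) (ht' : t' ∈ T) (h : ∀ i, t i - t' i = α i) :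
    BExt A B C (α 2) (α 1 - A * α 2) (α 0 - B * α 2 - A * (α 1 - A * α 2)) := by
  let St := {p : T × T × (Fin 3 → ℤ) // ∀ i, p.1.1 i - p.2.1.1 i = p.2.2 i}
  have hstep : ∀ p : St, ∃ q : St, -(C - 1) ≤ q.1.2.2 0 + C * p.1.2.2 2 ∧
      q.1.2.2 0 + C * p.1.2.2 2 ≤ C - 1 ∧ q.1.2.2 1 = p.1.2.2 0 - B * p.1.2.2 2 ∧
      q.1.2.2 2 = p.1.2.2 1 - A * p.1.2.2 2 := by
    rintro ⟨⟨⟨s, hs⟩, ⟨s', hs'⟩, β⟩, hp⟩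
    dsimp only at hp
    obtain ⟨u, hu, i, hi0, hi1, a0, a1, a2⟩ := tile_step hT hs
    obtain ⟨u', hu', i', hi0', hi1', b0, b1, b2⟩ := tile_step hT hs'
    have p0 := hp 0
    have p1 := hp 1
    have p2 := hp 2
    refine ⟨⟨⟨⟨u, hu⟩, ⟨u', hu'⟩, ![-(C * β 2) - i + i', β 0 - B * β 2, β 1 - A * β 2]⟩, ?_⟩, ?_⟩
    · intro j
      fin_cases j
      · simp
        rw [← p2]; linarith
      · simp
        rw [← p2, ← p0]; linarith
      · simp
        rw [← p2, ← p1]; linarith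
    · refine ⟨?_, ?_, by simp, by simp⟩ <;> simp <;> omega
  choose nx hnx using hstep
  let s0 : St := ⟨⟨⟨t, ht⟩, ⟨t', ht'⟩, α⟩, h⟩
  let sq : ℕ → St := fun k => nx^[k] s0
  have hsq : ∀ k, sq (k + 1) = nx (sq k) := fun k => Function.iterate_succ_apply' _ _ _
  let β : ℕ → Fin 3 → ℤ := fun k => (sq k).1.2.2
  have hβ : ∀ k, -(C - 1) ≤ β (k+1) 0 + C * β k 2 ∧
      β (k+1) 0 + C * β k 2 ≤ C - 1 ∧ β (k+1) 1 = β k 0 - B * β k 2 ∧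
      β (k+1) 2 = β k 1 - A * β k 2 := by
    intro k
    have := hnx (sq k)
    rw [← hsq] at this
    exact this
  obtain ⟨R, hR⟩ := tile_bdd hT
  refine ⟨fun k => β k 2, ⌈2 * R⌉, ?_, ?_, rfl, ?_, ?_⟩
  · intro k
    obtain ⟨x0, x1, x2, x3⟩ := hβ k
    obtain ⟨y0, y1, y2, y3⟩ := hβ (k+1)
    obtain ⟨w0, w1, w2, w3⟩ := hβ (k+2)
    dsimp only
    have e : β (k+3) 2 + A * β (k+2) 2 + B * β (k+1) 2 = β (k+1) 0 := by
      have : β (k+3) 2 = β (k+2) 1 - A * β (k+2) 2 := w3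
      have h2 : β (k+2) 1 = β (k+1) 0 - B * β (k+1) 2 := y2
      linarith
    rw [e]
    exact ⟨x0, x1⟩
  · intro k
    have h1 := (sq k).2 2
    have h2 := hR _ (sq k).1.1.2 2
    have h3 := hR _ (sq k).1.2.1.2 2
    have h4 : |((β k 2 : ℤ) : ℝ)| ≤ 2 * R := by
      change |(((sq k).1.2.2 2 : ℤ) : ℝ)| ≤ 2 * R
      rw [← h1]
      exact (abs_sub _ _).trans (by linarith)
    have h5 : ((|β k 2| : ℤ) : ℝ) ≤ (⌈2 * R⌉ : ℤ) := by
      push_cast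
      exact h4.trans (Int.le_ceil _)
    exact_mod_cast h5
  · exact (hβ 0).2.2.2
  · have a := (hβ 0).2.2.2
    have b := (hβ 1).2.2.2
    have c := (hβ 0).2.2.1
    dsimp only
    change β 2 2 = _
    change β 2 2 = β 1 1 - A * β 1 2 at b
    rw [b]
    change β 1 2 = α 1 - A * α 2 at a
    change β 1 1 = α 0 - B * α 2 at c
    rw [a, c]

/-- contraction of the backward linear recurrence (one block) -/
theorem contract1 (A B C : ℝ) (hA : 1 ≤ A) (hB : A ≤ B) (hC : B + 1 ≤ C) (w : ℕ → ℝ) (N : ℕ)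
    (h : ∀ k, k + 3 ≤ N → w (k+3) + A * w (k+2) + B * w (k+1) + C * w k = 0) (K : ℝ)
    (hb : ∀ k ≤ N, |w k| ≤ K) (k : ℕ) (hk : k + 6 ≤ N) :
    w k ≤ (1 - 1 / (2 * C ^ 3)) * K := by
  have hC2 : 2 ≤ C := by linarith
  have hK : 0 ≤ K := (abs_nonneg _).trans (hb 0 (Nat.zero_le _))
  -- averaging step
  have avg : ∀ j, j + 4 ≤ N → ∀ ε, (1 - ε) * K ≤ w j → (1 - C * ε) * K ≤ w (j+1) := by
    intro j hj ε hε
    have e0 := h j (by omega)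
    have e1 := h (j+1) (by omega)
    have b1 := (abs_le.1 (hb (j+1) (by omega))).2
    have b2 := (abs_le.1 (hb (j+2) (by omega))).2
    have b3 := (abs_le.1 (hb (j+3) (by omega))).2
    have b4 := (abs_le.1 (hb (j+4) (by omega))).2
    have e : C * w j = (C - B) * w (j+1) + (B - A) * w (j+2) + (A - 1) * w (j+3) + w (j+4) := by
      have e1' : w (j+4) + A * w (j+3) + B * w (j+2) + C * w (j+1) = 0 := e1
      linarith
    have m2 : (B - A) * w (j+2) ≤ (B - A) * K := mul_le_mul_of_nonneg_left b2 (by linarith)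
    have m3 : (A - 1) * w (j+3) ≤ (A - 1) * K := mul_le_mul_of_nonneg_left b3 (by linarith)
    have m0 : C * ((1 - ε) * K) ≤ C * w j := mul_le_mul_of_nonneg_left hε (by linarith)
    have m1 : (C - B - 1) * w (j+1) ≤ (C - B - 1) * K :=
      mul_le_mul_of_nonneg_left b1 (by linarith)
    nlinarith
  by_contra hcon
  push Not at hcon
  have a1 := avg k (by omega) _ hcon.le
  have a2 := avg (k+1) (by omega) _ a1
  have a3 := avg (k+2) (by omega) _ a2
  have hC0 : C ≠ 0 := by linarith
  have r : C * (C * (C * (1 / (2 * C ^ 3)))) = 1 / 2 := by field_simp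
  have hCp : 0 < C * (1 / (2 * C ^ 3)) := by positivity
  have hεp : 0 < (1 / (2 * C ^ 3)) := by positivity
  have le1 : C * (C * (1 / (2 * C ^ 3))) ≤ 1 / 2 := by nlinarith
  have le2 : C * (1 / (2 * C ^ 3)) ≤ 1 / 2 := by nlinarith
  have le3 : (1 / (2 * C ^ 3)) ≤ 1 / 2 := by nlinarith
  rw [r] at a3
  have n3 : 0 ≤ w (k+3) := le_trans (by nlinarith) a3
  have n2 : 0 ≤ w (k+2) := le_trans (mul_nonneg (by linarith) hK) a2
  have n1 : 0 ≤ w (k+1) := le_trans (mul_nonneg (by linarith) hK) a1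
  have n0 : 0 < w k := lt_of_le_of_lt (mul_nonneg (by linarith) hK) hcon
  have e0 := h k (by omega)
  have p1 : 0 ≤ A * w (k+2) := mul_nonneg (by linarith) n2
  have p2 : 0 ≤ B * w (k+1) := mul_nonneg (by linarith) n1
  have p3 : 0 < C * w k := mul_pos (by linarith) n0
  linarith

theorem contract (A B C : ℝ) (hA : 1 ≤ A) (hB : A ≤ B) (hC : B + 1 ≤ C) (w : ℕ → ℝ) (K : ℝ)
    (n : ℕ) : ∀ N, (∀ k, k + 3 ≤ N → w (k+3) + A * w (k+2) + B * w (k+1) + C * w k = 0) →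
    (∀ k ≤ N, |w k| ≤ K) → ∀ k, k + 6 * n ≤ N → |w k| ≤ (1 - 1 / (2 * C ^ 3)) ^ n * K := by
  induction n with
  | zero =>
    intro N _ hb k hk
    simpa using hb k (by omega)
  | succ n ih =>
    intro N h hb k hk
    have hb' : ∀ j ≤ N - 6 * n, |w j| ≤ (1 - 1 / (2 * C ^ 3)) ^ n * K :=
      fun j hj => ih N h hb j (by omega)
    have u := contract1 A B C hA hB hC w (N - 6 * n) (fun j hj => h j (by omega)) _ hb' k (by omega)
    have l := contract1 A B C hA hB hC (fun j => -w j) (N - 6 * n)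
      (fun j hj => by have := h j (by omega); linarith) _
      (fun j hj => by rw [abs_neg]; exact hb' j hj) k (by omega)
    rw [pow_succ, abs_le]
    constructor <;> linarith

theorem ext_to_nb {A B C : ℤ} {T : Set (Fin 3 → ℝ)} (hT : IsABCTile A B C T)
    (a b c : ℤ) (h : BExt A B C a b c) :
    ∃ t ∈ T, ∃ t' ∈ T, t 2 - t' 2 = a ∧ t 1 - t' 1 = b + A * a ∧
      t 0 - t' 0 = c + A * b + B * a := by
  obtain ⟨hA, hB, hC, ⟨x0, hx0⟩, hcomp, -, -⟩ := id hT
  obtain ⟨z, R, hz, hzR, rfl, rfl, rfl⟩ := h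
  obtain ⟨R', hR'⟩ := tile_bdd hT
  -- approximations
  have key : ∀ N : ℕ, ∀ y : ℕ → ℤ, Ok A B C y → (∀ k, |y k| ≤ R) →
      ∃ t ∈ T, ∃ t' ∈ T, ∃ w : ℕ → ℝ,
        (∀ k, k + 3 ≤ N → w (k+3) + A * w (k+2) + B * w (k+1) + C * w k = 0) ∧
        (∀ k, k ≤ N → |w k| ≤ 2 * R' + R) ∧ t 2 - t' 2 - y 0 = w 0 ∧
        (1 ≤ N → t 1 - t' 1 - (y 1 + A * y 0) = w 1 + A * w 0) ∧
        (2 ≤ N → t 0 - t' 0 - (y 2 + A * y 1 + B * y 0) = w 2 + A * w 1 + B * w 0) := by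
    intro N
    induction N with
    | zero =>
      intro y hy hyR
      refine ⟨x0, hx0, x0, hx0, fun _ => -y 0, by intro k hk; omega, ?_, by ring,
        by intro h; omega, by intro h; omega⟩
      intro k _
      have h1 : |((y 0 : ℤ) : ℝ)| ≤ R := by exact_mod_cast hyR 0
      have h2 := (abs_nonneg _).trans (hR' x0 hx0 0)
      rw [abs_neg]
      linarith
    | succ N ih =>
      intro y hy hyR
      obtain ⟨s, hs, s', hs', w, w1, w2, w3, w4, w5⟩ :=
        ih (fun k => y (k+1)) (fun k => hy (k+1)) (fun k => hyR (k+1))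
      -- the digits
      have hy0 := hy 0
      simp only [zero_add] at hy0
      obtain ⟨i, i', hi, hi', hj, hj', hij⟩ : ∃ i i' : ℤ, 0 ≤ i ∧ i < C ∧ 0 ≤ i' ∧ i' < C ∧
          i' - i = y 3 + A * y 2 + B * y 1 + C * y 0 := by
        generalize y 3 + A * y 2 + B * y 1 + C * y 0 = m at hy0
        rcases le_total 0 m with hm | hm
        · exact ⟨0, m, by omega, by omega, by omega, by omega, by omega⟩
        · exact ⟨-m, 0, by omega, by omega, by omega, by omega, by omega⟩
      have hijR : (i' : ℝ) - i = y 3 + A * y 2 + B * y 1 + C * y 0 := by exact_mod_cast hij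
      obtain ⟨t, ht, t0, t1, t2⟩ := tile_back hT hs i hi hi'
      obtain ⟨t', ht', t0', t1', t2'⟩ := tile_back hT hs' i' hj hj'
      refine ⟨t, ht, t', ht', fun k => if k = 0 then t 2 - t' 2 - y 0 else w (k - 1),
        ?_, ?_, by simp, ?_, ?_⟩
      · intro k hk
        rcases k with _ | k
        · have h5 := w5 (by omega)
          simp
          linarith
        · have := w1 k (by omega)
          simpa using this
      · intro k hk
        rcases k with _ | k
        · have h1 : |((y 0 : ℤ) : ℝ)| ≤ R := by exact_mod_cast hyR 0
          have h2 := abs_le.1 (hR' t ht 2)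
          have h3 := abs_le.1 (hR' t' ht' 2)
          have h4 := abs_le.1 h1
          simp only [if_true]
          rw [abs_le]
          constructor <;> linarith [h2.1, h2.2, h3.1, h3.2, h4.1, h4.2]
        · have := w2 k (by omega)
          simpa using this
      · intro _
        simp
        norm_num at w3
        linarith
      · intro h2
        have h4 := w4 (by omega)
        simp
        norm_num at w3 h4
        linarith
  -- pass to the limit using compactness
  have hclosed : IsClosed ((fun p : (Fin 3 → ℝ) × (Fin 3 → ℝ) => p.1 - p.2) '' (T ×ˢ T)) :=
    ((hcomp.prod hcomp).image (by fun_prop)).isClosed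
  let target : Fin 3 → ℝ := ![z 2 + A * z 1 + B * z 0, z 1 + A * z 0, z 0]
  have hmem : target ∈ ((fun p : (Fin 3 → ℝ) × (Fin 3 → ℝ) => p.1 - p.2) '' (T ×ˢ T)) := by
    choose t ht t' ht' w w1 w2 w3 w4 w5 using fun n : ℕ => key (6 * n + 2) z hz hzR
    have hAr : (1 : ℝ) ≤ A := by exact_mod_cast hA
    have hBr : (A : ℝ) ≤ B := by exact_mod_cast hB
    have hCr : (B : ℝ) + 1 ≤ C := by exact_mod_cast hC
    have hbd : ∀ j ≤ 2, Filter.Tendsto (fun n => w n j) Filter.atTop (nhds 0) := by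
      intro j hj
      have hle : ∀ n, |w n j| ≤ (1 - 1 / (2 * (C : ℝ) ^ 3)) ^ n * (2 * R' + R) := fun n =>
        contract A B C hAr hBr hCr (w n) _ n (6 * n + 2) (w1 n) (w2 n) j (by omega)
      refine squeeze_zero_norm hle ?_
      have hC2 : (2 : ℝ) ≤ C := by linarith
      have hC3 : 1 ≤ (C : ℝ) ^ 3 := one_le_pow₀ (by linarith)
      have hq : 1 / (2 * (C : ℝ) ^ 3) ≤ 1 := by
        rw [div_le_one (by positivity)]; linarith
      have hq' : 0 < 1 / (2 * (C : ℝ) ^ 3) := by positivity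
      have := (tendsto_pow_atTop_nhds_zero_of_lt_one (r := 1 - 1 / (2 * (C : ℝ) ^ 3))
        (by linarith) (by linarith)).mul_const (2 * R' + (R : ℝ))
      simpa using this
    have lim : Filter.Tendsto (fun n => t n - t' n) Filter.atTop (nhds target) := by
      have l0 := hbd 0 (by omega)
      have l1 := hbd 1 (by omega)
      have l2 := hbd 2 (by omega)
      rw [tendsto_pi_nhds]
      intro i
      fin_cases i
      · have := ((l2.add (l1.const_mul (A : ℝ))).add (l0.const_mul (B : ℝ))).add_const
          ((z 2 : ℝ) + A * z 1 + B * z 0)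
        simp only [mul_zero, zero_add] at this
        refine this.congr fun n => ?_
        have := w5 n (by omega)
        simp
        linarith
      · have := (l1.add (l0.const_mul (A : ℝ))).add_const ((z 1 : ℝ) + A * z 0)
        simp only [mul_zero, zero_add] at this
        refine this.congr fun n => ?_
        have := w4 n (by omega)
        simp
        linarith
      · have := l0.add_const (z 0 : ℝ)
        simp only [zero_add] at this
        refine this.congr fun n => ?_
        have := w3 n
        simp
        linarith
    exact hclosed.mem_of_tendsto lim (Filter.Eventually.of_forall fun n =>
      ⟨(t n, t' n), ⟨ht n, ht' n⟩, rfl⟩)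
  obtain ⟨⟨t, t'⟩, ⟨ht, ht'⟩, he⟩ := hmem
  have h0 := congrFun he 0
  have h1 := congrFun he 1
  have h2 := congrFun he 2
  simp [target] at h0 h1 h2
  exact ⟨t, ht, t', ht', h2, h1, h0⟩

/-- coordinates on `ℤ³` in terms of the three initial entries of the sequence -/
def coords (A B : ℤ) (α : Fin 3 → ℤ) : ℤ × ℤ × ℤ :=
  (α 2, α 1 - A * α 2, α 0 - B * α 2 - A * (α 1 - A * α 2))

theorem coords_inj (A B : ℤ) : Function.Injective (coords A B) := by
  intro α β h
  simp only [coords, Prod.mk.injEq] at h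
  obtain ⟨h2, h1, h0⟩ := h
  rw [h2] at h1 h0
  have h1' : α 1 = β 1 := by linarith
  rw [h1'] at h0
  have h0' : α 0 = β 0 := by linarith
  ext i
  fin_cases i <;> assumption

theorem coords_image {A B C : ℤ} {T : Set (Fin 3 → ℝ)} (hT : IsABCTile A B C T) :
    coords A B '' Neighbors T = {p | p ≠ 0 ∧ BExt A B C p.1 p.2.1 p.2.2} := by
  have h00 : coords A B 0 = 0 := by simp [coords]
  ext ⟨a, b, c⟩
  constructor
  · rintro ⟨α, ⟨hα, x, hx, y, hy, hxy⟩, hp⟩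
    rw [← hp]
    refine ⟨fun h => hα (coords_inj A B (h.trans h00.symm)), ?_⟩
    refine nb_to_ext hT α x y hx hy fun i => ?_
    rw [← hxy]
    simp [toR]
  · rintro ⟨hne, hE⟩
    obtain ⟨t, ht, t', ht', e2, e1, e0⟩ := ext_to_nb hT a b c hE
    have hco : coords A B ![c + A * b + B * a, b + A * a, a] = (a, b, c) := by
      simp [coords]
    refine ⟨![c + A * b + B * a, b + A * a, a], ⟨?_, t, ht, t', ht', ?_⟩, hco⟩
    · intro h
      rw [h, h00] at hco
      exact hne hco.symm
    · ext i
      fin_cases i <;> simp [toR] <;> linarith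

/-- the 14 alternating words -/
noncomputable def W14 : Finset (ℤ × ℤ × ℤ) :=
  (Finset.Icc (-1) 1 ×ˢ Finset.Icc (-1) 1 ×ˢ Finset.Icc (-1) 1).filter fun p =>
    p ≠ 0 ∧ p.1 + p.2.1 ≤ 1 ∧ -1 ≤ p.1 + p.2.1 ∧ p.2.1 + p.2.2 ≤ 1 ∧ -1 ≤ p.2.1 + p.2.2 ∧
      p.1 + p.2.1 + p.2.2 ≤ 1 ∧ -1 ≤ p.1 + p.2.1 + p.2.2

theorem card_W14 : W14.card = 14 := by decide

theorem mem_W14 (p : ℤ × ℤ × ℤ) : p ∈ W14 ↔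
    p ≠ 0 ∧ (|p.1| ≤ 1 ∧ |p.2.1| ≤ 1 ∧ |p.2.2| ≤ 1) ∧ Alt p.1 p.2.1 p.2.2 := by
  simp only [W14, Finset.mem_filter, Finset.mem_product, Finset.mem_Icc, Alt, abs_le]
  tauto

theorem stmt2 (A B C : ℤ) (T : Set (Fin 3 → ℝ)) (hT : IsABCTile A B C T) :
    (Neighbors T).ncard = 14 ↔
      ((1 ≤ A ∧ A < B ∧ B < C ∧ 2 * A - 1 ≤ B ∧ 2 * (B - A) + 2 ≤ C) ∨
       (1 ≤ A ∧ A < B ∧ B < C ∧ B < 2 * A - 1 ∧ A + B - 2 ≤ C)) := by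
  change _ ↔ Cnd A B C
  have hA := hT.1
  have hB := hT.2.1
  have hC := hT.2.2.1
  rw [← Set.ncard_image_of_injective _ (coords_inj A B), coords_image hT]
  have hsub : (W14 : Set (ℤ × ℤ × ℤ)) ⊆ {p | p ≠ 0 ∧ BExt A B C p.1 p.2.1 p.2.2} := by
    intro p hp
    obtain ⟨h0, ⟨h1, h2, h3⟩, h4⟩ := (mem_W14 p).1 hp
    exact ⟨h0, lower A B C _ _ _ hA hB hC h1 h2 h3 h4⟩
  constructor
  · intro hcard
    by_contra hn
    obtain ⟨a, b, c, hne, hE⟩ := extra A B C hA hB hC hn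
    have hfin := Set.finite_of_ncard_pos (hcard ▸ (by norm_num : 0 < 14))
    have hx : (a, b, c) ∉ W14 := fun h => hne ((mem_W14 _).1 h).2
    have hsub' : ((insert (a, b, c) W14 : Finset (ℤ × ℤ × ℤ)) : Set (ℤ × ℤ × ℤ)) ⊆
        {p | p ≠ 0 ∧ BExt A B C p.1 p.2.1 p.2.2} := by
      rw [Finset.coe_insert]
      refine Set.insert_subset ⟨?_, hE⟩ hsub
      intro h0
      simp only [Prod.mk_eq_zero] at h0
      obtain ⟨rfl, rfl, rfl⟩ := h0
      exact hne (by simp [Alt])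
    have := Set.ncard_le_ncard hsub' hfin
    rw [Set.ncard_coe_finset, Finset.card_insert_of_notMem hx, card_W14, hcard] at this
    omega
  · intro hc
    have : {p : ℤ × ℤ × ℤ | p ≠ 0 ∧ BExt A B C p.1 p.2.1 p.2.2} = (W14 : Set (ℤ × ℤ × ℤ)) := by
      refine Set.Subset.antisymm ?_ hsub
      rintro p ⟨h0, z, R, hz, hR, e0, e1, e2⟩
      have := upper_alt A B C R z hc hz hR
      rw [e0, e1, e2] at this
      exact (mem_W14 p).2 ⟨h0, this⟩
    rw [this, Set.ncard_coe_finset, card_W14]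
end

section
/- Let T be an ABC-tile with 1 ≤ A < B < C, and suppose that either (B ≥ 2A − 1 and C ≥ 2(B − A) + 2) or (B < 2A − 1 and C ≥ A + B − 2). Then the neighbor set of T is exactly the 14-element set S = {±(1,0,0), ±(A−1,1,0), ±(A,1,0), ±(B−A,A−1,1), ±(B−A+1,A−1,1), ±(B−1,A,1), ±(B,A,1)}. -/
open MeasureTheory

/-- All block sums of the triple `(a,b,c)` are bounded by `k`. -/
def Wk (k a b c : ℤ) : Prop :=
  (-k ≤ a ∧ a ≤ k) ∧ (-k ≤ b ∧ b ≤ k) ∧ (-k ≤ c ∧ c ≤ k) ∧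
  (-k ≤ a + b ∧ a + b ≤ k) ∧ (-k ≤ b + c ∧ b + c ≤ k) ∧ (-k ≤ a + b + c ∧ a + b + c ≤ k)

/-- The step condition for four consecutive terms. -/
def Stp (A B C a b c d : ℤ) : Prop :=
  -(C - 1) ≤ C * a + B * b + A * c + d ∧ C * a + B * b + A * c + d ≤ C - 1

theorem wk_pred {A B C k a b c d : ℤ} (hA : 1 ≤ A) (hAB : A ≤ B) (hBC : B < C)
    (h : Stp A B C a b c d) (hw : Wk k b c d) : Wk k a b c := by
  obtain ⟨h1, h2⟩ := h
  have n1 : ¬ (1 ≤ a ∧ 1 ≤ a + b ∧ 1 ≤ a + b + c ∧ 1 ≤ a + b + c + d) := by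
    rintro ⟨p1, p2, p3, p4⟩
    have q1 := mul_nonneg (sub_nonneg.2 hBC.le) (sub_nonneg.2 p1)
    have q2 := mul_nonneg (sub_nonneg.2 hAB) (sub_nonneg.2 p2)
    have q3 := mul_nonneg (sub_nonneg.2 hA) (sub_nonneg.2 p3)
    nlinarith
  have n2 : ¬ (a ≤ -1 ∧ a + b ≤ -1 ∧ a + b + c ≤ -1 ∧ a + b + c + d ≤ -1) := by
    rintro ⟨p1, p2, p3, p4⟩
    have q1 := mul_nonneg (sub_nonneg.2 hBC.le) (sub_nonneg.2 p1)
    have q2 := mul_nonneg (sub_nonneg.2 hAB) (sub_nonneg.2 p2)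
    have q3 := mul_nonneg (sub_nonneg.2 hA) (sub_nonneg.2 p3)
    nlinarith
  clear h1 h2
  unfold Wk at *
  omega

theorem wk_split {k a b c : ℤ} (hk : 2 ≤ k) (h : Wk k a b c) :
    ∃ x y z, Wk 2 x y z ∧ Wk (k - 2) (a - x) (b - y) (c - z) := by
  obtain ⟨m, hm⟩ : ∃ m : ℤ, m = min (min 0 a) (min (a + b) (a + b + c)) := ⟨_, rfl⟩
  refine ⟨min (a - m) 2 - min (0 - m) 2, min (a + b - m) 2 - min (a - m) 2,
    min (a + b + c - m) 2 - min (a + b - m) 2, ?_, ?_⟩ <;> unfold Wk at * <;> omega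

theorem stp_split {A B C r0 r1 r2 r3 : ℤ} (hC : 0 < C) (s1 s2 s3 : ℤ)
    (h : Stp A B C r0 r1 r2 r3) :
    ∃ s0, Stp A B C s0 s1 s2 s3 ∧ Stp A B C (r0 - s0) (r1 - s1) (r2 - s2) (r3 - s3) := by
  unfold Stp at *
  obtain ⟨e, he⟩ : ∃ e, e = C * r0 + B * r1 + A * r2 + r3 := ⟨_, rfl⟩
  obtain ⟨z, hz⟩ : ∃ z, z = B * s1 + A * s2 + s3 := ⟨_, rfl⟩
  obtain ⟨d, d', h1, h2, h3, h4, h5⟩ :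
      ∃ d d' : ℤ, 0 ≤ d ∧ d < C ∧ 0 ≤ d' ∧ d' < C ∧ e = d' - d := by
    rw [← he] at h
    rcases le_total 0 e with h0 | h0
    · exact ⟨0, e, by omega⟩
    · exact ⟨-e, 0, by omega⟩
  have g1 := Int.emod_nonneg (z + d) hC.ne'
  have g2 := Int.emod_lt_of_pos (z + d) hC
  have g3 := Int.mul_ediv_add_emod (z + d) C
  refine ⟨-((z + d) / C), ?_⟩
  have k1 : C * -((z + d) / C) + B * s1 + A * s2 + s3 = (z + d) % C - d := by
    linarith
  have k2 : C * (r0 - -((z + d) / C)) + B * (r1 - s1) + A * (r2 - s2) + (r3 - s3)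
      = d' - (z + d) % C := by
    linarith
  rw [k1, k2]
  omega

theorem back {A B C k r0 r1 r2 r3 s1 s2 s3 : ℤ} (hA : 1 ≤ A) (hAB : A ≤ B) (hBC : B < C)
    (h : Stp A B C r0 r1 r2 r3) (hs : Wk 2 s1 s2 s3)
    (ht : Wk k (r1 - s1) (r2 - s2) (r3 - s3)) :
    ∃ s0, Stp A B C s0 s1 s2 s3 ∧ Wk 2 s0 s1 s2 ∧ Wk k (r0 - s0) (r1 - s1) (r2 - s2) := by
  obtain ⟨s0, h1, h2⟩ := stp_split (by omega) s1 s2 s3 h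
  exact ⟨s0, h1, wk_pred hA hAB hBC h1 hs, wk_pred hA hAB hBC h2 ht⟩

theorem five {x : ℤ} (h1 : -2 ≤ x) (h2 : x ≤ 2) : x = 0 ∨ x = 1 ∨ x = -1 ∨ x = 2 ∨ x = -2 := by
  omega

instance (k a b c : ℤ) : Decidable (Wk k a b c) := by unfold Wk; infer_instance

set_option maxHeartbeats 0 in
theorem core {A B C r0 r1 r2 r3 r4 r5 r6 r7 r8 r9 : ℤ}
    (hA : 1 ≤ A) (hAB : A < B) (hBC : B < C)
    (hcond : (2 * A - 1 ≤ B ∧ 2 * (B - A) + 2 ≤ C) ∨ (B < 2 * A - 1 ∧ A + B - 2 ≤ C))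
    (w0 : Wk 2 r0 r1 r2) (w1 : Wk 2 r1 r2 r3) (w2 : Wk 2 r2 r3 r4) (w3 : Wk 2 r3 r4 r5)
    (w4 : Wk 2 r4 r5 r6) (w5 : Wk 2 r5 r6 r7) (w6 : Wk 2 r6 r7 r8) (w7 : Wk 2 r7 r8 r9)
    (e0 : Stp A B C r0 r1 r2 r3) (e1 : Stp A B C r1 r2 r3 r4) (e2 : Stp A B C r2 r3 r4 r5)
    (e3 : Stp A B C r3 r4 r5 r6) (e4 : Stp A B C r4 r5 r6 r7) (e5 : Stp A B C r5 r6 r7 r8)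
    (e6 : Stp A B C r6 r7 r8 r9) : Wk 1 r0 r1 r2 := by
  by_contra hb
  have nb1 : ¬ Wk 1 r1 r2 r3 := fun h => hb (wk_pred hA hAB.le hBC e0 h)
  have nb2 : ¬ Wk 1 r2 r3 r4 := fun h => nb1 (wk_pred hA hAB.le hBC e1 h)
  have nb3 : ¬ Wk 1 r3 r4 r5 := fun h => nb2 (wk_pred hA hAB.le hBC e2 h)
  have nb4 : ¬ Wk 1 r4 r5 r6 := fun h => nb3 (wk_pred hA hAB.le hBC e3 h)
  have nb5 : ¬ Wk 1 r5 r6 r7 := fun h => nb4 (wk_pred hA hAB.le hBC e4 h)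
  have nb6 : ¬ Wk 1 r6 r7 r8 := fun h => nb5 (wk_pred hA hAB.le hBC e5 h)
  have nb7 : ¬ Wk 1 r7 r8 r9 := fun h => nb6 (wk_pred hA hAB.le hBC e6 h)
  have f0 := five w0.1.1 w0.1.2
  have f1 := five w1.1.1 w1.1.2
  have f2 := five w2.1.1 w2.1.2
  have f3 := five w3.1.1 w3.1.2
  have f4 := five w4.1.1 w4.1.2
  have f5 := five w5.1.1 w5.1.2
  have f6 := five w6.1.1 w6.1.2
  have f7 := five w7.1.1 w7.1.2
  have f8 := five w7.2.1.1 w7.2.1.2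
  have f9 := five w7.2.2.1.1 w7.2.2.1.2
  unfold Stp at *
  rcases f0 with rfl | rfl | rfl | rfl | rfl <;> rcases f1 with rfl | rfl | rfl | rfl | rfl <;>
    rcases f2 with rfl | rfl | rfl | rfl | rfl <;>
    first | exact absurd w0 (by decide) | exact hb (by decide) | skip
  all_goals clear hb w0
  all_goals (rcases f3 with rfl | rfl | rfl | rfl | rfl)
  all_goals first | exact absurd w1 (by decide) | exact nb1 (by decide) | skip
  all_goals clear nb1 w1
  all_goals try (clear e1 e2 e3 e4 e5 e6 f4 f5 f6 f7 f8 f9; omega)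
  all_goals (rcases f4 with rfl | rfl | rfl | rfl | rfl)
  all_goals first | exact absurd w2 (by decide) | exact nb2 (by decide) | skip
  all_goals clear nb2 w2
  all_goals try (clear e2 e3 e4 e5 e6 f5 f6 f7 f8 f9; omega)
  all_goals (rcases f5 with rfl | rfl | rfl | rfl | rfl)
  all_goals first | exact absurd w3 (by decide) | exact nb3 (by decide) | skip
  all_goals clear nb3 w3
  all_goals try (clear e3 e4 e5 e6 f6 f7 f8 f9; omega)
  all_goals (rcases f6 with rfl | rfl | rfl | rfl | rfl)
  all_goals first | exact absurd w4 (by decide) | exact nb4 (by decide) | skip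
  all_goals clear nb4 w4
  all_goals try (clear e4 e5 e6 f7 f8 f9; omega)
  all_goals (rcases f7 with rfl | rfl | rfl | rfl | rfl)
  all_goals first | exact absurd w5 (by decide) | exact nb5 (by decide) | skip
  all_goals clear nb5 w5
  all_goals try (clear e5 e6 f8 f9; omega)
  all_goals (rcases f8 with rfl | rfl | rfl | rfl | rfl)
  all_goals first | exact absurd w6 (by decide) | exact nb6 (by decide) | skip
  all_goals clear nb6 w6
  all_goals try (clear e6 f9; omega)
  all_goals (rcases f9 with rfl | rfl | rfl | rfl | rfl)
  all_goals first | exact absurd w7 (by decide) | exact nb7 (by decide) | skip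
  all_goals clear nb7 w7
  all_goals omega

theorem descend {A B C : ℤ} (hA : 1 ≤ A) (hAB : A < B) (hBC : B < C)
    (hcond : (2 * A - 1 ≤ B ∧ 2 * (B - A) + 2 ≤ C) ∨ (B < 2 * A - 1 ∧ A + B - 2 ≤ C))
    {X : ℤ → ℤ → ℤ → Prop} (hX : ∀ a b c, X a b c → ∃ d, X b c d ∧ Stp A B C a b c d)
    {k : ℤ} (hk : 2 ≤ k) (hb : ∀ a b c, X a b c → Wk k a b c) :
    ∀ a b c, X a b c → Wk (k - 1) a b c := by
  intro r0 r1 r2 h0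
  obtain ⟨r3, h1, e0⟩ := hX _ _ _ h0
  obtain ⟨r4, h2, e1⟩ := hX _ _ _ h1
  obtain ⟨r5, h3, e2⟩ := hX _ _ _ h2
  obtain ⟨r6, h4, e3⟩ := hX _ _ _ h3
  obtain ⟨r7, h5, e4⟩ := hX _ _ _ h4
  obtain ⟨r8, h6, e5⟩ := hX _ _ _ h5
  obtain ⟨r9, h7, e6⟩ := hX _ _ _ h6
  obtain ⟨s7, s8, s9, w7, t7⟩ := wk_split hk (hb _ _ _ h7)
  obtain ⟨s6, g6, w6, t6⟩ := back hA hAB.le hBC e6 w7 t7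
  obtain ⟨s5, g5, w5, t5⟩ := back hA hAB.le hBC e5 w6 t6
  obtain ⟨s4, g4, w4, t4⟩ := back hA hAB.le hBC e4 w5 t5
  obtain ⟨s3, g3, w3, t3⟩ := back hA hAB.le hBC e3 w4 t4
  obtain ⟨s2, g2, w2, t2⟩ := back hA hAB.le hBC e2 w3 t3
  obtain ⟨s1, g1, w1, t1⟩ := back hA hAB.le hBC e1 w2 t2
  obtain ⟨s0, g0, w0, t0⟩ := back hA hAB.le hBC e0 w1 t1
  have w := core hA hAB hBC hcond w0 w1 w2 w3 w4 w5 w6 w7 g0 g1 g2 g3 g4 g5 g6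
  clear hX hb
  unfold Wk at w t0 ⊢
  omega

theorem descend_all {A B C : ℤ} (hA : 1 ≤ A) (hAB : A < B) (hBC : B < C)
    (hcond : (2 * A - 1 ≤ B ∧ 2 * (B - A) + 2 ≤ C) ∨ (B < 2 * A - 1 ∧ A + B - 2 ≤ C))
    {X : ℤ → ℤ → ℤ → Prop} (hX : ∀ a b c, X a b c → ∃ d, X b c d ∧ Stp A B C a b c d)
    (k : ℕ) (hb : ∀ a b c, X a b c → Wk (k + 1) a b c) :
    ∀ a b c, X a b c → Wk 1 a b c := by
  induction k with
  | zero => simpa using hb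
  | succ n ih =>
    apply ih
    intro a b c h
    have := descend hA hAB hBC hcond hX (by push_cast; omega) hb a b c h
    simpa using this

theorem wk_succ {A B C a b c : ℤ} (hA : 1 ≤ A) (hAB : A ≤ B) (hBC : B < C) (h : Wk 1 a b c) :
    ∃ d, Wk 1 b c d ∧ Stp A B C a b c d := by
  obtain ⟨⟨h1, h2⟩, ⟨h3, h4⟩, ⟨h5, h6⟩, h7⟩ := h
  unfold Wk Stp
  interval_cases a <;> interval_cases b <;> interval_cases c <;>
    first
    | (exfalso; omega)
    | exact ⟨0, by omega⟩
    | exact ⟨1, by omega⟩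
    | exact ⟨-1, by omega⟩

/-- The vector with coordinates `(a,b,c)` in the adapted basis. -/
def vec (A B : ℤ) (a b c : ℝ) : Fin 3 → ℝ := ![c + A * b + B * a, b + A * a, a]

theorem Mmat_mulVec (A B C : ℤ) (v : Fin 3 → ℝ) :
    (Mmat A B C).mulVec v = ![-(C : ℝ) * v 2, v 0 - B * v 2, v 1 - A * v 2] := by
  ext i
  fin_cases i <;> simp [Mmat, Matrix.mulVec, dotProduct, Fin.sum_univ_three] <;> ring

theorem tile_fwd {A B C : ℤ} {T : Set (Fin 3 → ℝ)}
    (hT : (Mmat A B C).mulVec '' T = ⋃ d ∈ Ddig C, tileTranslate d T) {x : Fin 3 → ℝ}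
    (hx : x ∈ T) : ∃ i : ℤ, 0 ≤ i ∧ i < C ∧ ∃ y ∈ T, (Mmat A B C).mulVec x = y + ![(i : ℝ), 0, 0] := by
  have h : (Mmat A B C).mulVec x ∈ (Mmat A B C).mulVec '' T := ⟨x, hx, rfl⟩
  rw [hT] at h
  simp only [Set.mem_iUnion] at h
  obtain ⟨d, ⟨i, h0, h1, rfl⟩, y, hy, he⟩ := h
  exact ⟨i, h0, h1, y, hy, he.symm⟩

theorem tile_bwd {A B C : ℤ} {T : Set (Fin 3 → ℝ)}
    (hT : (Mmat A B C).mulVec '' T = ⋃ d ∈ Ddig C, tileTranslate d T) {y : Fin 3 → ℝ}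
    (hy : y ∈ T) (i : ℤ) (h0 : 0 ≤ i) (h1 : i < C) :
    ∃ x ∈ T, (Mmat A B C).mulVec x = y + ![(i : ℝ), 0, 0] := by
  have h : y + ![(i : ℝ), 0, 0] ∈ (Mmat A B C).mulVec '' T := by
    rw [hT]
    simp only [Set.mem_iUnion]
    exact ⟨_, ⟨i, h0, h1, rfl⟩, y, hy, rfl⟩
  exact h

/-- The difference set. -/
def Fd (T : Set (Fin 3 → ℝ)) : Set (Fin 3 → ℝ) := Set.image2 (fun x y => x - y) T T

theorem fd_fwd {A B C : ℤ} {T : Set (Fin 3 → ℝ)}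
    (hT : (Mmat A B C).mulVec '' T = ⋃ d ∈ Ddig C, tileTranslate d T) (a b c : ℤ)
    (h : vec A B a b c ∈ Fd T) : ∃ d : ℤ, vec A B b c d ∈ Fd T ∧ Stp A B C a b c d := by
  obtain ⟨x, hx, y, hy, he⟩ := h
  obtain ⟨i, i0, i1, x', hx', ex⟩ := tile_fwd hT hx
  obtain ⟨j, j0, j1, y', hy', ey⟩ := tile_fwd hT hy
  refine ⟨-(C * a + B * b + A * c) + j - i, ⟨x', hx', y', hy', ?_⟩, ?_, ?_⟩
  · have e1 : (Mmat A B C).mulVec (vec A B a b c) = x' + ![(i : ℝ), 0, 0] - (y' + ![(j : ℝ), 0, 0]) := by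
      rw [← ex, ← ey, ← Matrix.mulVec_sub, ← he]
    rw [Mmat_mulVec] at e1
    have c0 := congrFun e1 0
    have c1 := congrFun e1 1
    have c2 := congrFun e1 2
    simp [vec, Matrix.vecHead, Matrix.vecTail] at c0 c1 c2
    ext t
    fin_cases t <;> simp [vec] <;> linarith
  · linarith
  · linarith

theorem fd_bwd {A B C : ℤ} {T : Set (Fin 3 → ℝ)}
    (hT : (Mmat A B C).mulVec '' T = ⋃ d ∈ Ddig C, tileTranslate d T) {a b c d : ℤ}
    (hs : Stp A B C a b c d) {v' : Fin 3 → ℝ} (hv' : v' ∈ Fd T) {y z w : ℝ}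
    (he : vec A B b c d - v' = vec A B y z w) :
    ∃ v ∈ Fd T, ∃ x : ℝ, vec A B a b c - v = vec A B x y z ∧ C * x + B * y + A * z + w = 0 := by
  obtain ⟨p, hp, q, hq, rfl⟩ := hv'
  obtain ⟨i, j, i0, i1, j0, j1, hij⟩ : ∃ i j : ℤ, 0 ≤ i ∧ i < C ∧ 0 ≤ j ∧ j < C ∧
      C * a + B * b + A * c + d = j - i := by
    obtain ⟨h1, h2⟩ := hs
    generalize C * a + B * b + A * c + d = e at *
    rcases le_total 0 e with h0 | h0
    · exact ⟨0, e, by omega⟩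
    · exact ⟨-e, 0, by omega⟩
  obtain ⟨p0, hp0, ep⟩ := tile_bwd hT hp i i0 i1
  obtain ⟨q0, hq0, eq⟩ := tile_bwd hT hq j j0 j1
  have hij' : (C : ℝ) * a + B * b + A * c + d = j - i := by exact_mod_cast hij
  refine ⟨p0 - q0, ⟨p0, hp0, q0, hq0, rfl⟩, (vec A B a b c - (p0 - q0)) 2, ?_⟩
  rw [Mmat_mulVec] at ep eq
  have p0' := congrFun ep 0
  have p1' := congrFun ep 1
  have p2' := congrFun ep 2
  have q0' := congrFun eq 0
  have q1' := congrFun eq 1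
  have q2' := congrFun eq 2
  have c0 := congrFun he 0
  have c1 := congrFun he 1
  have c2 := congrFun he 2
  simp [vec] at p0' p1' p2' q0' q1' q2' c0 c1 c2
  constructor
  · have k1 : b + A * a - (p0 1 - q0 1) = y + A * (a - (p0 2 - q0 2)) := by linarith
    have k0 : c + A * b + B * a - (p0 0 - q0 0) = z + A * y + B * (a - (p0 2 - q0 2)) := by
      linarith
    ext t
    fin_cases t <;> simp [vec]
    · linarith
    · linarith
  · simp [vec]
    linarith

/-- Real spread condition. -/
def SpR (K x y z : ℝ) : Prop :=
  ∃ m M : ℝ, M - m = K ∧ (m ≤ 0 ∧ 0 ≤ M) ∧ (m ≤ x ∧ x ≤ M) ∧ (m ≤ x + y ∧ x + y ≤ M) ∧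
    (m ≤ x + y + z ∧ x + y + z ≤ M)

theorem conv_step {A B C c p q1 q2 q3 q4 m M : ℝ} (hA : 1 ≤ A) (hAB : A ≤ B) (hC : 0 < C)
    (hc : c * C = C - B)
    (h : C * p = (C - B) * q1 + (B - A) * q2 + (A - 1) * q3 + q4)
    (h1 : m ≤ q1 ∧ q1 ≤ M) (h2 : m ≤ q2 ∧ q2 ≤ M) (h3 : m ≤ q3 ∧ q3 ≤ M)
    (h4 : m ≤ q4 ∧ q4 ≤ M) :
    m + c * (q1 - m) ≤ p ∧ p ≤ M - c * (M - q1) := by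
  have a1 := mul_nonneg (sub_nonneg.2 hAB) (sub_nonneg.2 h2.1)
  have a2 := mul_nonneg (sub_nonneg.2 hAB) (sub_nonneg.2 h2.2)
  have b1 := mul_nonneg (sub_nonneg.2 hA) (sub_nonneg.2 h3.1)
  have b2 := mul_nonneg (sub_nonneg.2 hA) (sub_nonneg.2 h3.2)
  constructor
  · refine le_of_mul_le_mul_left ?_ hC
    have : C * (m + c * (q1 - m)) = C * m + (C - B) * (q1 - m) := by rw [← hc]; ring
    rw [this, h]
    nlinarith [h4.1]
  · refine le_of_mul_le_mul_left ?_ hC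
    have : C * (M - c * (M - q1)) = C * M - (C - B) * (M - q1) := by rw [← hc]; ring
    rw [this, h]
    nlinarith [h4.2]

theorem contract_s3 {A B C c K x0 x1 x2 x3 x4 x5 : ℝ} (hA : 1 ≤ A) (hAB : A ≤ B) (hC : 0 < C)
    (hc : c * C = C - B) (hc0 : 0 ≤ c) (hc1 : c ≤ 1)
    (e0 : C * x0 + B * x1 + A * x2 + x3 = 0) (e1 : C * x1 + B * x2 + A * x3 + x4 = 0)
    (e2 : C * x2 + B * x3 + A * x4 + x5 = 0) (h : SpR K x3 x4 x5) :
    SpR ((1 - c ^ 3) * K) x0 x1 x2 := by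
  obtain ⟨m, M, rfl, h3, h4, h5, h6⟩ := h
  -- positions relative to the base point before `x3`
  have s2 := conv_step (p := -x2) (q1 := 0) (q2 := x3) (q3 := x3 + x4) (q4 := x3 + x4 + x5)
    hA hAB hC hc (by linarith) h3 h4 h5 h6
  have hm : 0 ≤ -m := by linarith
  have hM : 0 ≤ M := h3.2
  have t2 : m ≤ -x2 ∧ -x2 ≤ M := by
    constructor <;> nlinarith [mul_nonneg hc0 hm, mul_nonneg hc0 hM]
  have s1 := conv_step (p := -x1 - x2) (q1 := -x2) (q2 := 0) (q3 := x3) (q4 := x3 + x4)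
    hA hAB hC hc (by linarith) t2 h3 h4 h5
  have t1 : m ≤ -x1 - x2 ∧ -x1 - x2 ≤ M := by
    constructor <;> nlinarith [mul_nonneg hc0 (sub_nonneg.2 t2.1), mul_nonneg hc0 (sub_nonneg.2 t2.2)]
  have s0 := conv_step (p := -x0 - x1 - x2) (q1 := -x1 - x2) (q2 := -x2) (q3 := 0) (q4 := x3)
    hA hAB hC hc (by linarith) t1 t2 h3 h4
  -- uniform bounds
  have d1 : c ^ 3 ≤ c ^ 2 := by nlinarith [sq_nonneg c]
  have d2 : c ^ 2 ≤ c := by nlinarith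
  have d3 : c ≤ 1 := hc1
  have l2 : -c * m ≤ -x2 - m := by linarith [s2.1]
  have u2 : c * M ≤ M + x2 := by linarith [s2.2]
  have l1 : -c ^ 2 * m ≤ -x1 - x2 - m := by nlinarith [s1.1, mul_le_mul_of_nonneg_left l2 hc0]
  have u1 : c ^ 2 * M ≤ M + x1 + x2 := by nlinarith [s1.2, mul_le_mul_of_nonneg_left u2 hc0]
  have l0 : -c ^ 3 * m ≤ -x0 - x1 - x2 - m := by
    nlinarith [s0.1, mul_le_mul_of_nonneg_left l1 hc0]
  have u0 : c ^ 3 * M ≤ M + x0 + x1 + x2 := by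
    nlinarith [s0.2, mul_le_mul_of_nonneg_left u1 hc0]
  have v1 := mul_le_mul_of_nonneg_right d1 hm
  have v2 := mul_le_mul_of_nonneg_right d2 hm
  have v3 := mul_le_mul_of_nonneg_right d3 hm
  have z1 := mul_le_mul_of_nonneg_right d1 hM
  have z2 := mul_le_mul_of_nonneg_right d2 hM
  have z3 := mul_le_mul_of_nonneg_right d3 hM
  refine ⟨m - c ^ 3 * m + x0 + x1 + x2, M - c ^ 3 * M + x0 + x1 + x2, by ring, ?_, ?_, ?_, ?_⟩ <;>
    constructor <;> linarith

theorem approx {A B C : ℤ} {T : Set (Fin 3 → ℝ)} (hA : 1 ≤ A) (hAB : A ≤ B) (hBC : B < C)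
    (hne : T.Nonempty)
    (hT : (Mmat A B C).mulVec '' T = ⋃ d ∈ Ddig C, tileTranslate d T) {κ : ℝ}
    (hκ : κ = 1 - (((C : ℝ) - B) / C) ^ 3) (N : ℕ) : ∀ a b c : ℤ, Wk 1 a b c →
    ∃ v ∈ Fd T, ∃ x y z : ℝ, vec A B a b c - v = vec A B x y z ∧ SpR (κ ^ N * 2) x y z := by
  have hAr : (1 : ℝ) ≤ A := by exact_mod_cast hA
  have hABr : (A : ℝ) ≤ B := by exact_mod_cast hAB
  have hBCr : (B : ℝ) < C := by exact_mod_cast hBC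
  have hC : (0 : ℝ) < C := by linarith
  induction N with
  | zero =>
    intro a b c h
    obtain ⟨t, ht⟩ := hne
    refine ⟨0, ⟨t, ht, t, ht, by simp⟩, a, b, c, by simp, -1, 1, by norm_num, by norm_num, ?_⟩
    unfold Wk at h
    norm_cast
    omega
  | succ N ih =>
    intro a b c h
    obtain ⟨d, h1, e1⟩ := wk_succ hA hAB hBC h
    obtain ⟨d', h2, e2⟩ := wk_succ hA hAB hBC h1
    obtain ⟨d'', h3, e3⟩ := wk_succ hA hAB hBC h2
    obtain ⟨v3, hv3, x3, x4, x5, f3, g3⟩ := ih _ _ _ h3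
    obtain ⟨v2, hv2, x2, f2, k2⟩ := fd_bwd hT e3 hv3 f3
    obtain ⟨v1, hv1, x1, f1, k1⟩ := fd_bwd hT e2 hv2 f2
    obtain ⟨v0, hv0, x0, f0, k0⟩ := fd_bwd hT e1 hv1 f1
    refine ⟨v0, hv0, x0, x1, x2, f0, ?_⟩
    have := contract_s3 (c := ((C : ℝ) - B) / C) hAr hABr hC (by field_simp)
      (div_nonneg (by linarith) hC.le) (by rw [div_le_one hC]; linarith) k0 k1 k2 g3
    rw [← hκ] at this
    convert this using 1
    ring

theorem fd_compact {T : Set (Fin 3 → ℝ)} (hc : IsCompact T) : IsCompact (Fd T) := by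
  have : Fd T = (fun p : (Fin 3 → ℝ) × (Fin 3 → ℝ) => p.1 - p.2) '' (T ×ˢ T) := by
    ext v
    simp [Fd, Set.mem_image2, and_assoc]
  rw [this]
  exact (hc.prod hc).image (by fun_prop)

theorem mem_fd {A B C : ℤ} {T : Set (Fin 3 → ℝ)} (hA : 1 ≤ A) (hAB : A ≤ B) (hBC : B < C)
    (hne : T.Nonempty) (hc : IsCompact T)
    (hT : (Mmat A B C).mulVec '' T = ⋃ d ∈ Ddig C, tileTranslate d T) {a b c : ℤ}
    (h : Wk 1 a b c) : vec A B a b c ∈ Fd T := by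
  have hAr : (1 : ℝ) ≤ A := by exact_mod_cast hA
  have hABr : (A : ℝ) ≤ B := by exact_mod_cast hAB
  have hBCr : (B : ℝ) < C := by exact_mod_cast hBC
  have hC : (0 : ℝ) < C := by linarith
  rw [← (fd_compact hc).isClosed.closure_eq, Metric.mem_closure_iff]
  intro ε hε
  obtain ⟨κ, hκ⟩ : ∃ κ : ℝ, κ = 1 - (((C : ℝ) - B) / C) ^ 3 := ⟨_, rfl⟩
  have q0 : 0 < ((C : ℝ) - B) / C := div_pos (by linarith) hC
  have q1 : ((C : ℝ) - B) / C ≤ 1 := by rw [div_le_one hC]; linarith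
  have k0 : 0 ≤ κ := by rw [hκ]; linarith [pow_le_one₀ (n := 3) q0.le q1]
  have k1 : κ < 1 := by rw [hκ]; linarith [pow_pos q0 3]
  have hL : (0 : ℝ) < 2 * (1 + A + B) := by linarith
  obtain ⟨N, hN⟩ := exists_pow_lt_of_lt_one (div_pos hε hL) k1
  obtain ⟨v, hv, x, y, z, he, m, M, hK, h0, h1, h2, h3⟩ := approx hA hAB hBC hne hT hκ N a b c h
  refine ⟨v, hv, ?_⟩
  rw [dist_eq_norm, he]
  rw [lt_div_iff₀ hL] at hN
  obtain ⟨δ, hδ⟩ : ∃ δ : ℝ, δ = κ ^ N * 2 := ⟨_, rfl⟩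
  have hδ' : (1 + A + B) * δ < ε := by rw [hδ]; linarith
  rw [← hδ] at hK
  have xb : |x| ≤ δ := abs_le.2 ⟨by linarith, by linarith⟩
  have yb : |y| ≤ δ := abs_le.2 ⟨by linarith, by linarith⟩
  have zb : |z| ≤ δ := abs_le.2 ⟨by linarith, by linarith⟩
  have δ0 : 0 ≤ δ := (abs_nonneg x).trans xb
  have A0 : (0 : ℝ) ≤ A := by linarith
  have B0 : (0 : ℝ) ≤ B := by linarith
  refine lt_of_le_of_lt ((pi_norm_le_iff_of_nonneg (r := (1 + A + B) * δ) (by positivity)).2 ?_) hδ'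
  rw [abs_le] at xb yb zb
  have ax := mul_le_mul_of_nonneg_left xb.1 A0
  have ax' := mul_le_mul_of_nonneg_left xb.2 A0
  have ay := mul_le_mul_of_nonneg_left yb.1 A0
  have ay' := mul_le_mul_of_nonneg_left yb.2 A0
  have bx := mul_le_mul_of_nonneg_left xb.1 B0
  have bx' := mul_le_mul_of_nonneg_left xb.2 B0
  have ad := mul_nonneg A0 δ0
  have bd := mul_nonneg B0 δ0
  intro i
  rw [Real.norm_eq_abs, abs_le]
  fin_cases i <;> simp [vec] <;> constructor <;> linarith

theorem fd_bdd {A B : ℤ} {T : Set (Fin 3 → ℝ)} (hA : 1 ≤ A) (hAB : A ≤ B) (hc : IsCompact T) :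
    ∃ k : ℕ, ∀ a b c : ℤ, vec A B a b c ∈ Fd T → Wk (k + 1) a b c := by
  obtain ⟨K0, hK0⟩ := (fd_compact hc).isBounded.exists_norm_le
  obtain ⟨K, hK⟩ := exists_nat_ge K0
  obtain ⟨A', rfl⟩ := Int.eq_ofNat_of_zero_le (show 0 ≤ A by omega)
  obtain ⟨B', rfl⟩ := Int.eq_ofNat_of_zero_le (show 0 ≤ B by omega)
  refine ⟨K + (K + A' * K) + (K + A' * (K + A' * K) + B' * K), fun a b c h => ?_⟩
  have hn := hK0 _ h
  have hi : ∀ i, |vec A' B' a b c i| ≤ K := fun i => (norm_le_pi_norm _ i).trans (hn.trans hK)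
  have i0 := hi 0
  have i1 := hi 1
  have i2 := hi 2
  simp [vec] at i0 i1 i2
  norm_cast at i0 i1 i2
  rw [abs_le] at i0 i1 i2
  have A0 : (0 : ℤ) ≤ A' := by omega
  have B0 : (0 : ℤ) ≤ B' := by omega
  have ax := mul_le_mul_of_nonneg_left i2.1 A0
  have ax' := mul_le_mul_of_nonneg_left i2.2 A0
  have bx := mul_le_mul_of_nonneg_left i2.1 B0
  have bx' := mul_le_mul_of_nonneg_left i2.2 B0
  have yl : -((K : ℤ) + A' * K) ≤ b := by linarith
  have yu : b ≤ (K : ℤ) + A' * K := by linarith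
  have ay := mul_le_mul_of_nonneg_left yl A0
  have ay' := mul_le_mul_of_nonneg_left yu A0
  have zl : -((K : ℤ) + A' * (K + A' * K) + B' * K) ≤ c := by linarith
  have zu : c ≤ (K : ℤ) + A' * (K + A' * K) + B' * K := by linarith
  have e : ((K + (K + A' * K) + (K + A' * (K + A' * K) + B' * K) : ℕ) : ℤ) =
    K + (K + A' * K) + (K + A' * (K + A' * K) + B' * K) := by push_cast; ring
  rw [e]
  generalize (K : ℤ) + A' * (K + A' * K) + B' * K = Z at *
  generalize (K : ℤ) + A' * K = Y at *
  unfold Wk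
  clear ax ax' bx bx' ay ay' e hi hn i0 i1
  omega

theorem neighbors_iff {T : Set (Fin 3 → ℝ)} (A B : ℤ) (α : Fin 3 → ℤ) :
    α ∈ Neighbors T ↔ α ≠ 0 ∧ vec A B (α 2 : ℤ) (α 1 - A * α 2 : ℤ)
      (α 0 - A * (α 1 - A * α 2) - B * α 2 : ℤ) ∈ Fd T := by
  have : vec A B (α 2 : ℤ) (α 1 - A * α 2 : ℤ) (α 0 - A * (α 1 - A * α 2) - B * α 2 : ℤ) = toR α := by
    ext i
    fin_cases i <;> simp [vec, toR]
    ring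
  rw [this]
  unfold Neighbors Fd
  simp only [Set.mem_setOf_eq]
  refine and_congr_right fun _ => ⟨?_, ?_⟩
  · rintro ⟨x, hx, y, hy, rfl⟩
    exact ⟨_, hx, y, hy, by simp⟩
  · rintro ⟨x, hx, y, hy, he⟩
    refine ⟨x, hx, y, hy, ?_⟩
    simp only at he ⊢
    rw [← he]
    abel

theorem list_iff (A B : ℤ) (α : Fin 3 → ℤ) :
    (α ∈ ({![1, 0, 0], -![1, 0, 0], ![A - 1, 1, 0], -![A - 1, 1, 0], ![A, 1, 0], -![A, 1, 0],
        ![B - A, A - 1, 1], -![B - A, A - 1, 1], ![B - A + 1, A - 1, 1], -![B - A + 1, A - 1, 1],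
        ![B - 1, A, 1], -![B - 1, A, 1], ![B, A, 1], -![B, A, 1]} : Set (Fin 3 → ℤ))) ↔
    α ≠ 0 ∧ Wk 1 (α 2) (α 1 - A * α 2) (α 0 - A * (α 1 - A * α 2) - B * α 2) := by
  simp only [Set.mem_insert_iff, Set.mem_singleton_iff, funext_iff, Fin.forall_fin_succ, ne_eq]
  simp
  generalize α 0 = p
  generalize α 1 = q
  generalize α 2 = r
  constructor
  · intro h
    rcases h with ⟨rfl, rfl, rfl⟩ | ⟨rfl, rfl, rfl⟩ | ⟨rfl, rfl, rfl⟩ | ⟨rfl, rfl, rfl⟩ |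
      ⟨rfl, rfl, rfl⟩ | ⟨rfl, rfl, rfl⟩ | ⟨rfl, rfl, rfl⟩ | ⟨rfl, rfl, rfl⟩ | ⟨rfl, rfl, rfl⟩ |
      ⟨rfl, rfl, rfl⟩ | ⟨rfl, rfl, rfl⟩ | ⟨rfl, rfl, rfl⟩ | ⟨rfl, rfl, rfl⟩ | ⟨rfl, rfl, rfl⟩ <;>
      refine ⟨by omega, ?_⟩ <;> unfold Wk <;> ring_nf <;> omega
  · rintro ⟨h0, h⟩
    obtain ⟨b, hb⟩ : ∃ b, b = q - A * r := ⟨_, rfl⟩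
    obtain ⟨c, hc⟩ : ∃ c, c = p - A * b - B * r := ⟨_, rfl⟩
    rw [← hb, ← hc] at h
    obtain rfl : q = b + A * r := by linarith
    obtain rfl : p = c + A * b + B * r := by linarith
    clear hb hc
    obtain ⟨⟨h1, h2⟩, ⟨h3, h4⟩, ⟨h5, h6⟩, h7⟩ := h
    interval_cases r <;> interval_cases b <;> interval_cases c <;>
      first
      | (exfalso; omega)
      | (repeat (first | exact Or.inl (by omega) | right)
         try omega)

theorem stmt3 (A B C : ℤ) (T : Set (Fin 3 → ℝ)) (hT : IsABCTile A B C T)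
    (hAB : A < B)
    (hcond : (2 * A - 1 ≤ B ∧ 2 * (B - A) + 2 ≤ C) ∨ (B < 2 * A - 1 ∧ A + B - 2 ≤ C)) :
    Neighbors T =
      ({![1, 0, 0], -![1, 0, 0], ![A - 1, 1, 0], -![A - 1, 1, 0], ![A, 1, 0], -![A, 1, 0],
        ![B - A, A - 1, 1], -![B - A, A - 1, 1], ![B - A + 1, A - 1, 1], -![B - A + 1, A - 1, 1],
        ![B - 1, A, 1], -![B - 1, A, 1], ![B, A, 1], -![B, A, 1]} : Set (Fin 3 → ℤ)) := by
  obtain ⟨hA, hAB', hBC, hne, hcpt, -, heq⟩ := hT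
  ext α
  rw [list_iff, neighbors_iff A B]
  refine and_congr_right fun _ => ⟨fun h => ?_, fun h => mem_fd hA hAB' hBC hne hcpt heq h⟩
  obtain ⟨k, hk⟩ := fd_bdd (A := A) (B := B) hA hAB' hcpt
  exact descend_all (X := fun a b c => vec A B a b c ∈ Fd T) hA hAB hBC hcond
    (fd_fwd heq) k hk _ _ _ h
end
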